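/- arXiv:0809.2551 — 4 statements merged into one kernel-verified Lean document; each statement's English description precedes it below -/
import Mathlib

section
/- Let T_n denote the number of spanning trees of the 2×n grid graph G_2(n). Then T_1 = 1, T_2 = 4, and for every n ≥ 3, T_n = 4·T_{n-1} − T_{n-2}. -/
open SimpleGraph

/-- The number of spanning trees of a simple graph `G`: the number of subgraphs of `G`
containing every vertex that are connected and acyclic. -/
noncomputable def spanningTreeCount {V : Type*} (G : SimpleGraph V) : ℕ :=
  Nat.card {H : G.Subgraph // H.IsSpanning ∧ H.coe.IsTree}

/-- The number of spanning trees of the `k × n` grid graph `G_k(n) = P_k □ P_n`. -/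
noncomputable def gridTreeCount (k n : ℕ) : ℕ :=
  spanningTreeCount (pathGraph k □ pathGraph n)

/-- The edge sets of the spanning trees of `G`, as simple graphs on the vertices of `G`. -/
def spanningTrees {V : Type*} (G : SimpleGraph V) : Set (SimpleGraph V) :=
  {H | H ≤ G ∧ H.IsTree}

/-- The spanning trees of `G` that use the edge `uv`. -/
def spanningTreesThrough {V : Type*} (G : SimpleGraph V) (u v : V) : Set (SimpleGraph V) :=
  {H | H ∈ spanningTrees G ∧ H.Adj u v}

lemma spanningTreeCount_eq_ncard {V : Type*} (G : SimpleGraph V) :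
    spanningTreeCount G = (spanningTrees G).ncard := by
  rw [← Nat.card_coe_set_eq]
  refine Nat.card_congr
    { toFun := fun H => ⟨H.1.spanningCoe, H.1.spanningCoe_le,
        (H.1.spanningCoeEquivCoeOfSpanning H.2.1).isTree_iff.2 H.2.2⟩
      invFun := fun H => ⟨SimpleGraph.toSubgraph H.1 H.2.1, fun _ => trivial,
        ((SimpleGraph.toSubgraph H.1 H.2.1).spanningCoeEquivCoeOfSpanning
          (fun _ => trivial)).isTree_iff.1 H.2.2⟩
      left_inv := fun H => ?_
      right_inv := fun H => rfl }
  apply Subtype.ext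
  apply Subgraph.ext
  · exact (Set.eq_univ_of_forall H.2.1).symm
  · rfl

lemma SimpleGraph.Iso.image_map_spanningTrees {V W : Type*} {G : SimpleGraph V}
    {G' : SimpleGraph W} (e : G ≃g G') :
    SimpleGraph.map e.toEquiv.toEmbedding '' spanningTrees G = spanningTrees G' := by
  ext H'
  constructor
  · rintro ⟨H, ⟨hle, ht⟩, rfl⟩
    refine ⟨?_, (SimpleGraph.Iso.map e.toEquiv H).isTree_iff.1 ht⟩
    rw [SimpleGraph.map_le_iff_le_comap]
    intro a b h
    exact e.map_rel_iff.2 (hle h)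
  · rintro ⟨hle, ht⟩
    refine ⟨H'.comap e.toEquiv, ⟨fun a b h => e.map_rel_iff.1 (hle h),
      (SimpleGraph.Iso.comap e.toEquiv H').isTree_iff.2 ht⟩, ?_⟩
    ext a b
    simp only [SimpleGraph.map_adj, SimpleGraph.comap_adj]
    constructor
    · rintro ⟨x, y, h, rfl, rfl⟩
      exact h
    · intro h
      exact ⟨e.symm a, e.symm b, by simpa using h, by simp, by simp⟩

lemma SimpleGraph.Iso.ncard_spanningTrees {V W : Type*} {G : SimpleGraph V}
    {G' : SimpleGraph W} (e : G ≃g G') :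
    (spanningTrees G).ncard = (spanningTrees G').ncard := by
  rw [← e.image_map_spanningTrees,
    Set.ncard_image_of_injective _ (SimpleGraph.map_injective _)]

lemma SimpleGraph.Iso.ncard_spanningTreesThrough {V W : Type*} {G : SimpleGraph V}
    {G' : SimpleGraph W} (e : G ≃g G') (u v : V) :
    (spanningTreesThrough G u v).ncard = (spanningTreesThrough G' (e u) (e v)).ncard := by
  have key : SimpleGraph.map e.toEquiv.toEmbedding '' spanningTreesThrough G u v =
      spanningTreesThrough G' (e u) (e v) := by
    have h (H : SimpleGraph V) :
        (H.map e.toEquiv.toEmbedding).Adj (e u) (e v) ↔ H.Adj u v :=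
      SimpleGraph.map_adj_apply (f := e.toEquiv.toEmbedding)
    ext H'
    simp only [spanningTreesThrough, ← e.image_map_spanningTrees, Set.mem_ofPred_eq, Set.mem_image]
    constructor
    · rintro ⟨H, ⟨hH, ha⟩, rfl⟩
      exact ⟨⟨H, hH, rfl⟩, (h H).2 ha⟩
    · rintro ⟨⟨H, hH, rfl⟩, ha⟩
      exact ⟨H, ⟨hH, (h H).1 ha⟩, rfl⟩
  rw [← key, Set.ncard_image_of_injective _ (SimpleGraph.map_injective _)]

/-- A graph is connected iff every two-valued potential that is constant along edges is
constant. -/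
lemma SimpleGraph.connected_iff_forall_potential {V : Type*} [Nonempty V] (G : SimpleGraph V) :
    G.Connected ↔ ∀ f : V → Prop, (∀ x y, G.Adj x y → f x → f y) → ∀ x y, f x → f y := by
  constructor
  · intro h f hf x y
    obtain ⟨w⟩ := h.preconnected x y
    induction w with
    | nil => exact id
    | cons ha _ ih => exact fun hx => ih (hf _ _ ha hx)
  · intro h
    exact ⟨fun x y => h (G.Reachable x) (fun _ _ ha hx => hx.trans ha.reachable) x y .rfl⟩

/-- Attach two new vertices to `H`: the new vertex `i` is joined to `p i` if `s i` holds, and the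
new vertices are joined to each other if `r` holds. -/
def attachRung {V : Type*} (H : SimpleGraph V) (p : Bool → V) (s : Bool → Prop) (r : Prop) :
    SimpleGraph (V ⊕ Bool) where
  Adj
    | .inl x, .inl y => H.Adj x y
    | .inl x, .inr i => x = p i ∧ s i
    | .inr i, .inl x => x = p i ∧ s i
    | .inr i, .inr j => i ≠ j ∧ r
  symm := ⟨by
    rintro (x | i) (y | j) h
    · exact h.symm
    · exact h
    · exact h
    · exact ⟨h.1.symm, h.2⟩⟩
  loopless := ⟨by
    rintro (x | i) h
    · exact H.irrefl h
    · exact h.1 rfl⟩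

section attachRung

variable {V : Type*} (H : SimpleGraph V) (p : Bool → V) (s : Bool → Prop) (r : Prop)

@[simp] lemma attachRung_adj_inl_inl (x y : V) :
    (attachRung H p s r).Adj (.inl x) (.inl y) ↔ H.Adj x y := Iff.rfl

@[simp] lemma attachRung_adj_inl_inr (x : V) (i : Bool) :
    (attachRung H p s r).Adj (.inl x) (.inr i) ↔ x = p i ∧ s i := Iff.rfl

@[simp] lemma attachRung_adj_inr_inl (x : V) (i : Bool) :
    (attachRung H p s r).Adj (.inr i) (.inl x) ↔ x = p i ∧ s i := Iff.rfl

@[simp] lemma attachRung_adj_inr_inr (i j : Bool) :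
    (attachRung H p s r).Adj (.inr i) (.inr j) ↔ i ≠ j ∧ r := Iff.rfl

open Classical in
lemma card_edgeSet_attachRung [Finite V] :
    Nat.card (attachRung H p s r).edgeSet = Nat.card H.edgeSet + (if s false then 1 else 0) +
      (if s true then 1 else 0) + (if r then 1 else 0) := by
  have him (x y : V ⊕ Bool) : s(x, y) ∈ Sym2.map Sum.inl '' H.edgeSet ↔
      ∃ a b, H.Adj a b ∧ x = .inl a ∧ y = .inl b := by
    constructor
    · rintro ⟨e, he, h⟩
      induction e with | _ a b
      rw [Sym2.map_mk, Sym2.eq_iff] at h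
      rcases h with ⟨rfl, rfl⟩ | ⟨rfl, rfl⟩
      · exact ⟨a, b, he, rfl, rfl⟩
      · exact ⟨b, a, he.symm, rfl, rfl⟩
    · rintro ⟨a, b, h, rfl, rfl⟩
      exact ⟨s(a, b), h, rfl⟩
  have hcard (e : Sym2 (V ⊕ Bool)) (P : Prop) :
      {e' | e' = e ∧ P}.ncard = if P then 1 else 0 := by
    split_ifs with h <;> simp [h]
  have key : (attachRung H p s r).edgeSet = Sym2.map Sum.inl '' H.edgeSet ∪
      {e | e = s(.inl (p false), .inr false) ∧ s false} ∪
      {e | e = s(.inl (p true), .inr true) ∧ s true} ∪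
      {e | e = s(.inr false, .inr true) ∧ r} := by
    ext e
    induction e with | _ x y
    simp only [Set.mem_union, him, SimpleGraph.mem_edgeSet, Set.mem_ofPred_eq, Sym2.eq_iff]
    rcases x with x | i <;> rcases y with y | j
    · simp
    · cases j <;> simp
    · cases i <;> simp
    · cases i <;> cases j <;> simp
  simp only [Nat.card_coe_set_eq]
  rw [key, Set.ncard_union_eq, Set.ncard_union_eq, Set.ncard_union_eq,
    Set.ncard_image_of_injective _ (Sym2.map.injective Sum.inl_injective), hcard, hcard, hcard]
  all_goals
    rw [Set.disjoint_left]
    intro e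
    induction e with | _ x y
    simp only [Set.mem_union, him, Set.mem_ofPred_eq, Sym2.eq_iff]
    grind

variable {H p s r}

lemma exists_side_of_connected_attachRung (h : (attachRung H p s r).Connected) :
    ∃ i, s i := by
  have : Nonempty (V ⊕ Bool) := ⟨.inr true⟩
  rw [connected_iff_forall_potential] at h
  by_contra! hs
  refine absurd (h (fun x => x.isRight) ?_ (.inr true) (.inl (p true)) rfl) (by simp)
  rintro (x | i) (y | j) ha
  · exact id
  · exact absurd ha.2 (hs j)
  · exact absurd ha.2 (hs i)
  · exact id

lemma rung_of_connected_attachRung (h : (attachRung H p s r).Connected) {i : Bool}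
    (hi : ¬ s i) : r := by
  have : Nonempty (V ⊕ Bool) := ⟨.inr true⟩
  rw [connected_iff_forall_potential] at h
  by_contra hr
  refine absurd (h (fun x => x = .inr i) ?_ (.inr i) (.inl (p i)) rfl) (by simp)
  rintro (x | j) (y | k) ha hx
  · cases hx
  · cases hx
  · cases hx
    exact absurd ha.2 hi
  · exact absurd ha.2 hr

lemma connected_attachRung_iff_of_not_and {i : Bool} (hi : s i) (h : ¬ (s (!i) ∧ r))
    (h' : s (!i) ∨ r) : (attachRung H p s r).Connected ↔ H.Connected := by
  have : Nonempty (V ⊕ Bool) := ⟨.inr true⟩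
  have : Nonempty V := ⟨p true⟩
  rw [connected_iff_forall_potential, connected_iff_forall_potential]
  constructor
  · intro hc f hf x y
    refine hc (Sum.elim f (fun j => s j ∧ f (p j) ∨ ¬ s j ∧ f (p (!j)))) ?_ (.inl x) (.inl y)
    rintro (x | j) (y | k) ha
    · exact hf x y ha
    · obtain ⟨rfl, hk⟩ := ha
      simp [hk]
    · obtain ⟨rfl, hk⟩ := ha
      simp [hk]
    · have hn : ¬ s (!i) := fun hn => h ⟨hn, ha.2⟩
      have hv (j) : s j ∧ f (p j) ∨ ¬ s j ∧ f (p (!j)) ↔ f (p i) := by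
        by_cases hj : j = i
        · subst hj
          simp [hi]
        · obtain rfl : j = !i := Bool.eq_not_of_ne hj
          simp [hn]
      exact fun hx => (hv k).2 ((hv j).1 hx)
  · intro hc f hf
    have hV (x y : V) : f (.inl x) → f (.inl y) :=
      hc (fun x => f (.inl x)) (fun x y ha => hf (.inl x) (.inl y) ha) x y
    have h1 (j) : f (.inr j) ↔ f (.inl (p i)) := by
      by_cases hj : s j
      · have a1 := hf (.inl (p j)) (.inr j) ⟨rfl, hj⟩
        have a2 := hf (.inr j) (.inl (p j)) ⟨rfl, hj⟩
        exact ⟨fun h => hV _ _ (a2 h), fun h => a1 (hV _ _ h)⟩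
      · have hne : i ≠ j := by rintro rfl; exact hj hi
        have hr : r := h'.resolve_left (by rwa [← Bool.eq_not_of_ne hne.symm])
        have a1 := hf (.inr i) (.inr j) ⟨hne, hr⟩
        have a2 := hf (.inr j) (.inr i) ⟨hne.symm, hr⟩
        have a3 := hf (.inl (p i)) (.inr i) ⟨rfl, hi⟩
        have a4 := hf (.inr i) (.inl (p i)) ⟨rfl, hi⟩
        tauto
    rintro (x | j) (y | k)
    · exact hV x y
    · rw [h1]; exact hV _ _
    · rw [h1]; exact hV _ _
    · rw [h1, h1]; exact id

lemma connected_attachRung_iff_of_forall (hs : ∀ i, s i) (hr : r) :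
    (attachRung H p s r).Connected ↔ (H ⊔ edge (p false) (p true)).Connected := by
  have : Nonempty (V ⊕ Bool) := ⟨.inr true⟩
  have : Nonempty V := ⟨p true⟩
  rw [connected_iff_forall_potential, connected_iff_forall_potential]
  constructor
  · intro hc f hf x y
    refine hc (Sum.elim f (fun j => f (p j))) ?_ (.inl x) (.inl y)
    rintro (x | j) (y | k) ha
    · exact hf x y (Or.inl ha)
    · obtain ⟨rfl, -⟩ := ha
      exact id
    · obtain ⟨rfl, -⟩ := ha
      exact id
    · obtain ⟨hne, -⟩ := ha
      by_cases hp : p j = p k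
      · simp [hp]
      · refine hf (p j) (p k) (Or.inr ?_)
        rw [edge_adj]
        cases j <;> cases k <;> simp_all
  · intro hc f hf
    have a1 (j) : f (.inl (p j)) ↔ f (.inr j) :=
      ⟨hf (.inl (p j)) (.inr j) ⟨rfl, hs j⟩, hf (.inr j) (.inl (p j)) ⟨rfl, hs j⟩⟩
    have a2 (j k) : f (.inr j) → f (.inr k) := by
      by_cases hjk : j = k
      · subst hjk; exact id
      · exact hf (.inr j) (.inr k) ⟨hjk, hr⟩
    have hV (x y : V) : f (.inl x) → f (.inl y) := by
      refine hc (fun x => f (.inl x)) (fun x y ha => ?_) x y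
      rcases ha with ha | ha
      · exact hf (.inl x) (.inl y) ha
      · rw [edge_adj] at ha
        rcases ha.1 with ⟨rfl, rfl⟩ | ⟨rfl, rfl⟩ <;>
        · simp only [a1]
          exact a2 _ _
    rintro (x | j) (y | k)
    · exact hV x y
    · rw [← a1]; exact hV _ _
    · rw [← a1]; exact hV _ _
    · exact a2 j k

lemma isTree_attachRung_iff_of_not_and [Finite V] {i : Bool} (hi : s i) (h : ¬ (s (!i) ∧ r))
    (h' : s (!i) ∨ r) : (attachRung H p s r).IsTree ↔ H.IsTree := by
  rw [isTree_iff_connected_and_card, isTree_iff_connected_and_card,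
    connected_attachRung_iff_of_not_and hi h h', card_edgeSet_attachRung, Nat.card_sum]
  refine and_congr_right fun _ => ?_
  simp only [Nat.card_eq_fintype_card (α := Bool), Fintype.card_bool]
  cases i <;> simp only [Bool.not_true, Bool.not_false] at h h' <;> grind

lemma isTree_attachRung_iff_of_forall [Finite V] (hp : p false ≠ p true) (hs : ∀ i, s i)
    (hr : r) : (attachRung H p s r).IsTree ↔
      ¬ H.Adj (p false) (p true) ∧ (H ⊔ edge (p false) (p true)).IsTree := by
  rw [isTree_iff_connected_and_card, isTree_iff_connected_and_card,
    connected_attachRung_iff_of_forall hs hr, card_edgeSet_attachRung, Nat.card_sum]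
  simp only [Nat.card_eq_fintype_card (α := Bool), Fintype.card_bool, hs, hr, if_true]
  by_cases ha : H.Adj (p false) (p true)
  · simp only [ha, not_true, false_and, iff_false, not_and, sup_edge_of_adj]
    intro hc
    have := hc.card_vert_le_card_edgeSet_add_one
    omega
  · have : Nat.card (H ⊔ edge (p false) (p true)).edgeSet = Nat.card H.edgeSet + 1 := by
      rw [edgeSet_sup, edgeSet_edge_of_ne hp, Nat.card_coe_set_eq, Nat.card_coe_set_eq,
        Set.union_singleton, Set.ncard_insert_of_notMem (by simpa using ha)]
    rw [this]
    simp only [ha, not_false_iff, true_and]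
    refine and_congr_right fun _ => ?_
    omega

variable (p s r) in
lemma attachRung_injective : Function.Injective fun H => attachRung H p s r :=
  Function.LeftInverse.injective (g := SimpleGraph.comap Sum.inl) fun _ => rfl

lemma attachRung_mono {G : SimpleGraph V} (h : H ≤ G) :
    attachRung H p s r ≤ attachRung G p (fun _ => True) True := by
  rintro (x | i) (y | j) ha
  · exact h ha
  · exact ⟨ha.1, trivial⟩
  · exact ⟨ha.1, trivial⟩
  · exact ⟨ha.1, trivial⟩

lemma exists_eq_attachRung {G : SimpleGraph V} {H' : SimpleGraph (V ⊕ Bool)}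
    (h : H' ≤ attachRung G p (fun _ => True) True) :
    ∃ H ≤ G, ∃ s r, H' = attachRung H p s r := by
  refine ⟨H'.comap Sum.inl, fun x y ha => h ha, fun i => H'.Adj (.inl (p i)) (.inr i),
    H'.Adj (.inr false) (.inr true), ?_⟩
  ext (x | i) (y | j)
  · rfl
  · refine ⟨fun ha => ?_, ?_⟩
    · obtain rfl : x = p j := (h ha).1
      exact ⟨rfl, ha⟩
    · rintro ⟨rfl, ha⟩
      exact ha
  · refine ⟨fun ha => ?_, ?_⟩
    · obtain rfl : y = p i := (h ha).1
      exact ⟨rfl, ha.symm⟩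
    · rintro ⟨rfl, ha⟩
      exact ha.symm
  · cases i <;> cases j <;> simp [H'.adj_comm]

variable {G : SimpleGraph V}

lemma image_sup_edge_eq_spanningTreesThrough {u v : V} (hG : G.Adj u v) :
    (fun H => H ⊔ edge u v) '' {H | H ≤ G ∧ ¬ H.Adj u v ∧ (H ⊔ edge u v).IsTree} =
      spanningTreesThrough G u v := by
  ext T
  constructor
  · rintro ⟨H, ⟨hle, -, ht⟩, rfl⟩
    exact ⟨⟨sup_le hle ((edge_le_iff _).2 (.inr hG)), ht⟩,
      .inr ((edge_adj _ _ _ _).2 ⟨.inl ⟨rfl, rfl⟩, hG.ne⟩)⟩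
  · rintro ⟨⟨hle, ht⟩, ha⟩
    have : T \ edge u v ⊔ edge u v = T := by
      rw [sdiff_sup_self, sup_eq_left]
      exact (edge_le_iff _).2 (.inr ha)
    refine ⟨T \ edge u v, ⟨sdiff_le.trans hle, fun h => ?_, by rwa [this]⟩, this⟩
    exact h.2 ((edge_adj _ _ _ _).2 ⟨.inl ⟨rfl, rfl⟩, hG.ne⟩)

lemma ncard_spanningTreesThrough {u v : V} (hG : G.Adj u v) :
    {H | H ≤ G ∧ ¬ H.Adj u v ∧ (H ⊔ edge u v).IsTree}.ncard =
      (spanningTreesThrough G u v).ncard := by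
  rw [← image_sup_edge_eq_spanningTreesThrough hG, Set.InjOn.ncard_image]
  rintro H ⟨-, h, -⟩ H' ⟨-, h', -⟩ heq
  have := congrArg (· \ edge u v) heq
  simpa [sup_sdiff, sdiff_edge _ h, sdiff_edge _ h'] using this

lemma spanningTreesThrough_attachRung [Finite V] (hp : p false ≠ p true) :
    spanningTreesThrough (attachRung G p (fun _ => True) True) (.inr false) (.inr true) =
      (fun H => attachRung H p (fun _ => True) True) ''
          {H | H ≤ G ∧ ¬ H.Adj (p false) (p true) ∧ (H ⊔ edge (p false) (p true)).IsTree} ∪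
        (fun H => attachRung H p (· = false) True) '' spanningTrees G ∪
        (fun H => attachRung H p (· = true) True) '' spanningTrees G := by
  ext H'
  constructor
  · rintro ⟨⟨hle, ht⟩, ha⟩
    obtain ⟨H, hH, s, r, rfl⟩ := exists_eq_attachRung hle
    obtain rfl : r = True := eq_true ha.2
    by_cases hs : ∀ i, s i
    · obtain rfl : s = fun _ => True := funext fun i => eq_true (hs i)
      exact .inl (.inl ⟨H, ⟨hH, (isTree_attachRung_iff_of_forall hp hs trivial).1 ht⟩, rfl⟩)
    · obtain ⟨i, hi⟩ := exists_side_of_connected_attachRung ht.connected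
      have hi' : ¬ s (!i) := fun h => hs fun j => by
        by_cases hj : j = i
        · rwa [hj]
        · rwa [Bool.eq_not_of_ne hj]
      obtain rfl : s = (· = i) := by
        ext j
        by_cases hj : j = i
        · simpa [hj] using hi
        · rw [Bool.eq_not_of_ne hj]
          simpa using hi'
      have := (isTree_attachRung_iff_of_not_and
        (s := (· = i)) (r := True) hi (by simp) (by simp)).1 ht
      cases i
      · exact .inl (.inr ⟨H, ⟨hH, this⟩, rfl⟩)
      · exact .inr ⟨H, ⟨hH, this⟩, rfl⟩
  · rintro ((⟨H, ⟨hle, h⟩, rfl⟩ | ⟨H, ⟨hle, h⟩, rfl⟩) | ⟨H, ⟨hle, h⟩, rfl⟩)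
    · exact ⟨⟨attachRung_mono hle, (isTree_attachRung_iff_of_forall hp (by simp) trivial).2 h⟩,
        by simp⟩
    · exact ⟨⟨attachRung_mono hle,
        (isTree_attachRung_iff_of_not_and (i := false) (by simp) (by simp) (by simp)).2 h⟩,
        by simp⟩
    · exact ⟨⟨attachRung_mono hle,
        (isTree_attachRung_iff_of_not_and (i := true) (by simp) (by simp) (by simp)).2 h⟩,
        by simp⟩

lemma spanningTrees_attachRung [Finite V] :
    spanningTrees (attachRung G p (fun _ => True) True) =
      spanningTreesThrough (attachRung G p (fun _ => True) True) (.inr false) (.inr true) ∪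
        (fun H => attachRung H p (fun _ => True) False) '' spanningTrees G := by
  ext H'
  constructor
  · intro h
    by_cases ha : H'.Adj (.inr false) (.inr true)
    · exact .inl ⟨h, ha⟩
    · obtain ⟨hle, ht⟩ := h
      obtain ⟨H, hH, s, r, rfl⟩ := exists_eq_attachRung hle
      obtain rfl : r = False := by simpa using ha
      obtain rfl : s = fun _ => True := by
        ext i
        simpa using by_contra fun hi => rung_of_connected_attachRung ht.connected hi
      refine .inr ⟨H, ⟨hH, ?_⟩, rfl⟩
      exact (isTree_attachRung_iff_of_not_and (i := true) (by simp) (by simp) (by simp)).1 ht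
  · rintro (h | ⟨H, ⟨hle, h⟩, rfl⟩)
    · exact h.1
    · exact ⟨attachRung_mono hle,
        (isTree_attachRung_iff_of_not_and (i := true) (by simp) (by simp) (by simp)).2 h⟩

lemma ncard_spanningTreesThrough_attachRung [Finite V] (hG : G.Adj (p false) (p true)) :
    (spanningTreesThrough (attachRung G p (fun _ => True) True)
      (.inr false) (.inr true)).ncard =
      (spanningTreesThrough G (p false) (p true)).ncard + 2 * (spanningTrees G).ncard := by
  rw [spanningTreesThrough_attachRung hG.ne, Set.ncard_union_eq, Set.ncard_union_eq,
    Set.ncard_image_of_injective _ (attachRung_injective _ _ _),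
    Set.ncard_image_of_injective _ (attachRung_injective _ _ _),
    Set.ncard_image_of_injective _ (attachRung_injective _ _ _),
    ncard_spanningTreesThrough hG]
  · ring
  · rw [Set.disjoint_left]
    rintro _ ⟨H, -, rfl⟩ ⟨H', -, h⟩
    simpa using congrArg (fun K => K.Adj (.inl (p true)) (.inr true)) h
  · rw [Set.disjoint_left]
    rintro _ (⟨H, -, rfl⟩ | ⟨H, -, rfl⟩) ⟨H', -, h⟩
    · simpa using congrArg (fun K => K.Adj (.inl (p false)) (.inr false)) h
    · simpa using congrArg (fun K => K.Adj (.inl (p true)) (.inr true)) h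

lemma ncard_spanningTrees_attachRung [Finite V] :
    (spanningTrees (attachRung G p (fun _ => True) True)).ncard =
      (spanningTreesThrough (attachRung G p (fun _ => True) True)
        (.inr false) (.inr true)).ncard + (spanningTrees G).ncard := by
  rw [spanningTrees_attachRung, Set.ncard_union_eq,
    Set.ncard_image_of_injective _ (attachRung_injective _ _ _)]
  rw [Set.disjoint_left]
  rintro _ ⟨-, h⟩ ⟨H', -, rfl⟩
  exact h.2

end attachRung

/-- The `2 × (n + 2)` grid is obtained from the `2 × (n + 1)` grid by attaching a rung to its last
column. -/
def attachRungIsoGrid (n : ℕ) :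
    attachRung (pathGraph 2 □ pathGraph (n + 1)) (fun i => (finTwoEquiv.symm i, Fin.last n))
      (fun _ => True) True ≃g (pathGraph 2 □ pathGraph (n + 2)) where
  toFun := Sum.elim (fun x => (x.1, x.2.castSucc)) (fun i => (finTwoEquiv.symm i, Fin.last (n + 1)))
  invFun x := Fin.lastCases (motive := fun _ => (Fin 2 × Fin (n + 1)) ⊕ Bool)
    (.inr (finTwoEquiv x.1)) (fun y => .inl (x.1, y)) x.2
  left_inv := by rintro (⟨x, y⟩ | i) <;> simp
  right_inv := by
    rintro ⟨x, y⟩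
    induction y using Fin.lastCases <;> simp
  map_rel_iff' := by
    rintro (⟨x, y⟩ | i) (⟨z, w⟩ | j)
    · simp [boxProd_adj, pathGraph_adj]
    · have hy := y.isLt
      simp [boxProd_adj, pathGraph_adj, Fin.ext_iff]
      omega
    · have hw := w.isLt
      simp [boxProd_adj, pathGraph_adj, Fin.ext_iff]
      omega
    · cases i <;> cases j <;> simp [boxProd_adj, pathGraph_adj, finTwoEquiv]

/-- The number of spanning trees of the `2 × (n + 1)` grid that use the last rung. -/
noncomputable def gridTreeThroughCount (n : ℕ) : ℕ :=
  (spanningTreesThrough (pathGraph 2 □ pathGraph (n + 1)) (0, Fin.last n) (1, Fin.last n)).ncard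

lemma gridTreeThroughCount_succ (n : ℕ) :
    gridTreeThroughCount (n + 1) = gridTreeThroughCount n + 2 * gridTreeCount 2 (n + 1) := by
  rw [gridTreeCount, spanningTreeCount_eq_ncard]
  have h := ncard_spanningTreesThrough_attachRung (G := pathGraph 2 □ pathGraph (n + 1))
    (p := fun i => (finTwoEquiv.symm i, Fin.last n))
    (by simp [boxProd_adj, pathGraph_adj, finTwoEquiv])
  rw [(attachRungIsoGrid n).ncard_spanningTreesThrough] at h
  exact h

lemma gridTreeCount_two_succ (n : ℕ) :
    gridTreeCount 2 (n + 2) = gridTreeThroughCount (n + 1) + gridTreeCount 2 (n + 1) := by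
  rw [gridTreeCount, gridTreeCount, spanningTreeCount_eq_ncard, spanningTreeCount_eq_ncard]
  have h := ncard_spanningTrees_attachRung (G := pathGraph 2 □ pathGraph (n + 1))
    (p := fun i => (finTwoEquiv.symm i, Fin.last n))
  rw [(attachRungIsoGrid n).ncard_spanningTreesThrough,
    (attachRungIsoGrid n).ncard_spanningTrees] at h
  exact h

lemma adj_of_connected_grid_two_one {H : SimpleGraph (Fin 2 × Fin 1)} (h : H.Connected) :
    H.Adj (0, 0) (1, 0) := by
  obtain ⟨⟨x, y⟩, hx⟩ := h.preconnected.exists_adj_of_nontrivial (0, 0)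
  obtain rfl := Subsingleton.elim y 0
  fin_cases x
  · exact absurd hx (H.irrefl)
  · exact hx

lemma spanningTrees_grid_two_one :
    spanningTrees (pathGraph 2 □ pathGraph 1) = {pathGraph 2 □ pathGraph 1} := by
  have hc : (pathGraph 2 □ pathGraph 1).Connected :=
    (pathGraph_connected 1).boxProd (pathGraph_connected 0)
  have hle {H : SimpleGraph (Fin 2 × Fin 1)} (h : H.Connected) :
      (pathGraph 2 □ pathGraph 1) ≤ H := by
    rintro ⟨x, y⟩ ⟨z, w⟩ ha
    obtain rfl := Subsingleton.elim y 0
    obtain rfl := Subsingleton.elim w 0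
    have := adj_of_connected_grid_two_one h
    fin_cases x <;> fin_cases z
    · exact absurd ha (SimpleGraph.irrefl _)
    · exact this
    · exact this.symm
    · exact absurd ha (SimpleGraph.irrefl _)
  ext H
  constructor
  · exact fun ⟨h, ht⟩ => h.antisymm (hle ht.connected)
  · rintro rfl
    obtain ⟨T, hT, ht⟩ := hc.exists_isTree_le
    exact ⟨le_rfl, by rwa [← hT.antisymm (hle ht.connected)]⟩

lemma gridTreeCount_two_one : gridTreeCount 2 1 = 1 := by
  rw [gridTreeCount, spanningTreeCount_eq_ncard, spanningTrees_grid_two_one, Set.ncard_singleton]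

lemma gridTreeThroughCount_zero : gridTreeThroughCount 0 = 1 := by
  rw [← gridTreeCount_two_one, gridTreeCount, spanningTreeCount_eq_ncard, gridTreeThroughCount]
  congr 1
  ext H
  exact ⟨fun h => h.1, fun h => ⟨h, adj_of_connected_grid_two_one h.2.connected⟩⟩

theorem gridTreeCount_two_recurrence :
    gridTreeCount 2 1 = 1 ∧ gridTreeCount 2 2 = 4 ∧
      ∀ n : ℕ, 3 ≤ n →
        (gridTreeCount 2 n : ℤ) =
          4 * gridTreeCount 2 (n - 1) - gridTreeCount 2 (n - 2) := by
  refine ⟨gridTreeCount_two_one, ?_, fun n hn => ?_⟩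
  · rw [gridTreeCount_two_succ, gridTreeThroughCount_succ, gridTreeThroughCount_zero,
      gridTreeCount_two_one]
  · obtain ⟨m, rfl⟩ := Nat.exists_eq_add_of_le' hn
    have h1 := gridTreeCount_two_succ m
    have h2 := gridTreeCount_two_succ (m + 1)
    have h3 := gridTreeThroughCount_succ (m + 1)
    simp only [show m + 3 - 1 = m + 2 by omega,
      show m + 3 - 2 = m + 1 by omega, show m + 1 + 2 = m + 3 by omega,
      show m + 1 + 1 = m + 2 by omega] at *
    omega
end

section
/- Let G be a finite simple graph on k vertices, let B_k denote the k-th Bell number, and let T_n denote the number of spanning trees of G □ P_n. Then the sequence (T_n) satisfies a linear recurrence of order B_k with integer coefficients: there exist integers c_1, …, c_{B_k} such that for all n ≥ 1, T_{n + B_k} = c_1·T_{n + B_k − 1} + c_2·T_{n + B_k − 2} + … + c_{B_k}·T_n. -/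
open SimpleGraph

namespace SimpleGraph

variable {V W W' : Type*}

theorem Reachable.eq_of_forall_adj {α : Type*} {F : SimpleGraph W} {f : W → α}
    (hf : ∀ a b, F.Adj a b → f a = f b) {a b : W} (h : F.Reachable a b) : f a = f b := by
  obtain ⟨p⟩ := h
  induction p with
  | nil => rfl
  | cons hadj _ ih => exact (hf _ _ hadj).trans ih

/-- The graph obtained from `F` and `H` by joining `ℓ v` to `v` for every `v ∈ Y`. -/
def glue (F : SimpleGraph W) (ℓ : V → W) (H : SimpleGraph V) (Y : Set V) :
    SimpleGraph (W ⊕ V) where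
  Adj
    | .inl a, .inl b => F.Adj a b
    | .inr u, .inr v => H.Adj u v
    | .inl a, .inr v => a = ℓ v ∧ v ∈ Y
    | .inr v, .inl a => a = ℓ v ∧ v ∈ Y
  symm := ⟨by
    rintro (a | u) (b | v) h
    exacts [Adj.symm (G := F) h, h, h, Adj.symm (G := H) h]⟩
  loopless := ⟨by
    rintro (a | u) h
    exacts [F.irrefl h, H.irrefl h]⟩

section glue

variable (F : SimpleGraph W) (ℓ : V → W) (H : SimpleGraph V) (Y : Set V)

@[simp] theorem glue_adj_inl_inl {a b : W} :
    (glue F ℓ H Y).Adj (.inl a) (.inl b) ↔ F.Adj a b := Iff.rfl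

@[simp] theorem glue_adj_inr_inr {u v : V} :
    (glue F ℓ H Y).Adj (.inr u) (.inr v) ↔ H.Adj u v := Iff.rfl

@[simp] theorem glue_adj_inl_inr {a : W} {v : V} :
    (glue F ℓ H Y).Adj (.inl a) (.inr v) ↔ a = ℓ v ∧ v ∈ Y := Iff.rfl

@[simp] theorem glue_adj_inr_inl {a : W} {v : V} :
    (glue F ℓ H Y).Adj (.inr v) (.inl a) ↔ a = ℓ v ∧ v ∈ Y := Iff.rfl

theorem glue_deleteEdges_inr_inr (u v : V) :
    (glue F ℓ H Y).deleteEdges {s(.inr u, .inr v)} = glue F ℓ (H.deleteEdges {s(u, v)}) Y := by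
  ext (a | a) (b | b) <;> simp

theorem glue_deleteEdges_inl_inr (v : V) :
    (glue F ℓ H Y).deleteEdges {s(.inl (ℓ v), .inr v)} = glue F ℓ H (Y \ {v}) := by
  ext (a | a) (b | b) <;> simp <;> grind

theorem glue_le_glue_univ_iff {K : SimpleGraph W} {G : SimpleGraph V} :
    glue F ℓ H Y ≤ glue K ℓ G Set.univ ↔ F ≤ K ∧ H ≤ G := by
  refine ⟨fun h ↦ ⟨fun a b hab ↦ ?_, fun a b hab ↦ ?_⟩, fun ⟨hF, hH⟩ ↦ ?_⟩
  · exact @h (.inl a) (.inl b) hab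
  · exact @h (.inr a) (.inr b) hab
  · rintro (a | a) (b | b) hab
    exacts [hF hab, ⟨hab.1, trivial⟩, ⟨hab.1, trivial⟩, hH hab]

theorem exists_glue_eq_of_le {K : SimpleGraph W} {G : SimpleGraph V} {T : SimpleGraph (W ⊕ V)}
    (hT : T ≤ glue K ℓ G Set.univ) :
    glue (T.comap Sum.inl) ℓ (T.comap Sum.inr) {v | T.Adj (.inl (ℓ v)) (.inr v)} = T := by
  ext (a | a) (b | b)
  · rfl
  · refine ⟨fun h ↦ ?_, fun h ↦ ?_⟩
    · obtain ⟨rfl, h⟩ := h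
      exact h
    · obtain ⟨rfl, -⟩ := hT h
      exact ⟨rfl, h⟩
  · refine ⟨fun h ↦ ?_, fun h ↦ ?_⟩
    · obtain ⟨rfl, h⟩ := h
      exact Adj.symm h
    · obtain ⟨rfl, -⟩ := hT h
      exact ⟨rfl, Adj.symm h⟩
  · rfl

variable {F ℓ H Y}

theorem glue_injective {F' : SimpleGraph W} {H' : SimpleGraph V} {Y' : Set V}
    (h : glue F ℓ H Y = glue F' ℓ H' Y') : F = F' ∧ H = H' ∧ Y = Y' := by
  refine ⟨?_, ?_, ?_⟩
  · ext a b
    exact iff_of_eq (congrArg (fun T : SimpleGraph (W ⊕ V) ↦ T.Adj (.inl a) (.inl b)) h)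
  · ext a b
    exact iff_of_eq (congrArg (fun T : SimpleGraph (W ⊕ V) ↦ T.Adj (.inr a) (.inr b)) h)
  · ext v
    simpa using congrArg (fun T : SimpleGraph (W ⊕ V) ↦ T.Adj (.inl (ℓ v)) (.inr v)) h

theorem IsAcyclic.map_inl (hF : F.IsAcyclic) :
    (F.map (Sum.inl : W → W ⊕ V)).IsAcyclic := by
  rw [isAcyclic_iff_forall_adj_isBridge]
  rintro x y ⟨-, a, b, hab, rfl, rfl⟩ hr
  refine (isAcyclic_iff_forall_adj_isBridge.1 hF hab) (ConnectedComponent.exact ?_)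
  have := hr.eq_of_forall_adj
    (f := Sum.elim (fun w ↦ some ((F.deleteEdges {s(a, b)}).connectedComponentMk w))
      fun _ ↦ none) ?_
  · simpa using this
  · rintro x y ⟨⟨-, c, d, hcd, rfl, rfl⟩, hne⟩
    simp only [Sum.elim_inl, Option.some.injEq]
    refine ConnectedComponent.sound (Adj.reachable ?_)
    rw [deleteEdges_adj]
    refine ⟨hcd, fun h ↦ hne ?_⟩
    simpa [hcd.ne] using h

theorem isAcyclic_glue_iff (hF : F.IsAcyclic) :
    (glue F ℓ H Y).IsAcyclic ↔
      (∀ u v, H.Adj u v →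
        ¬ (glue F ℓ (H.deleteEdges {s(u, v)}) Y).Reachable (.inr u) (.inr v)) ∧
      ∀ v ∈ Y, ¬ (glue F ℓ H (Y \ {v})).Reachable (.inl (ℓ v)) (.inr v) := by
  constructor
  · intro h
    rw [isAcyclic_iff_forall_adj_isBridge] at h
    refine ⟨fun u v huv ↦ ?_, fun v hv ↦ ?_⟩
    · rw [← glue_deleteEdges_inr_inr]
      exact @h (.inr u) (.inr v) huv
    · rw [← glue_deleteEdges_inl_inr]
      exact @h (.inl (ℓ v)) (.inr v) ⟨rfl, hv⟩
  · rintro ⟨hH, hY⟩ x c hc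
    have hbridge : ∀ y z, s(y, z) ∈ c.edges → ¬ (glue F ℓ H Y).IsBridge s(y, z) := fun y z he hb ↦
      (isBridge_iff_forall_cycle_notMem (c.edges_subset_edgeSet he)).1 hb c hc he
    have hvert : ∀ v ∈ Y, (glue F ℓ H Y).IsBridge s(.inl (ℓ v), .inr v) := fun v hv ↦ by
      rw [isBridge_iff, glue_deleteEdges_inl_inr]
      exact hY v hv
    have hedges : ∀ e ∈ c.edges, e ∈ (F.map (Sum.inl : W → W ⊕ V)).edgeSet := by
      intro e he
      induction e with | h y z
      have hadj := c.edges_subset_edgeSet he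
      rw [mem_edgeSet] at hadj
      rcases y with a | u <;> rcases z with b | v
      · exact ⟨by simpa using hadj.ne, a, b, hadj, rfl, rfl⟩
      · obtain ⟨rfl, hv⟩ := hadj
        exact (hbridge _ _ he (hvert v hv)).elim
      · obtain ⟨rfl, hv⟩ := hadj
        exact (hbridge _ _ he (Sym2.eq_swap ▸ hvert u hv)).elim
      · refine (hbridge _ _ he ?_).elim
        rw [isBridge_iff, glue_deleteEdges_inr_inr]
        exact hH u v hadj
    exact hF.map_inl _ (hc.transfer hedges)

/-- Connectivity in a gluing, between vertices close to the interface, only depends on the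
connectivity relation induced on the interface. -/
theorem Reachable.glue_congr {F' : SimpleGraph W'} {ℓ' : V → W'}
    (hreach : ∀ w, ∃ v, F.Reachable w (ℓ v))
    (hS : F.reachableSetoid.comap ℓ = F'.reachableSetoid.comap ℓ') {x y : V ⊕ V}
    (h : (glue F ℓ H Y).Reachable (x.map ℓ id) (y.map ℓ id)) :
    (glue F' ℓ' H Y).Reachable (x.map ℓ' id) (y.map ℓ' id) := by
  choose π hπ using hreach
  have hS' : ∀ u v, F.Reachable (ℓ u) (ℓ v) → F'.Reachable (ℓ' u) (ℓ' v) := fun u v huv ↦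
    (Setoid.ext_iff.1 hS u v).1 huv
  have hF' : ∀ a b, F'.Reachable a b → (glue F' ℓ' H Y).Reachable (.inl a) (.inl b) :=
    fun a b hab ↦ hab.map ⟨Sum.inl, fun h ↦ h⟩
  have hπℓ : ∀ x : V ⊕ V, (glue F' ℓ' H Y).Reachable
      (((x.map ℓ id).map π id).map ℓ' id) (x.map ℓ' id) := by
    rintro (v | v)
    · exact hF' _ _ (hS' _ _ (hπ _).symm)
    · rfl
  refine (hπℓ x).symm.trans (Reachable.trans (ConnectedComponent.exact ?_) (hπℓ y))
  refine h.eq_of_forall_adj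
    (f := fun z ↦ (glue F' ℓ' H Y).connectedComponentMk ((z.map π id).map ℓ' id)) ?_
  rintro (a | u) (b | v) hadj <;> refine ConnectedComponent.sound ?_
  · exact hF' _ _ (hS' _ _ ((hπ a).symm.trans (Reachable.trans (Adj.reachable hadj) (hπ b))))
  · obtain ⟨rfl, hv⟩ := hadj
    refine (hπℓ (.inl v)).trans (Adj.reachable ?_)
    exact ⟨rfl, hv⟩
  · obtain ⟨rfl, hv⟩ := hadj
    refine Reachable.trans (Adj.reachable ?_) (hπℓ (.inl u)).symm
    exact ⟨rfl, hv⟩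
  · exact Adj.reachable (show H.Adj u v from hadj)

theorem exists_reachable_of_glue {w : W} {v : V}
    (h : (glue F ℓ H Y).Reachable (.inl w) (.inr v)) : ∃ u, F.Reachable w (ℓ u) := by
  have := h.eq_of_forall_adj (f := Sum.elim (fun w ↦ ∃ u, F.Reachable w (ℓ u)) fun _ ↦ True) ?_
  · simpa using this
  · rintro (a | u) (b | v) hadj
    · have hab : F.Reachable a b := Adj.reachable hadj
      exact propext ⟨fun ⟨u, hu⟩ ↦ ⟨u, hab.symm.trans hu⟩, fun ⟨u, hu⟩ ↦ ⟨u, hab.trans hu⟩⟩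
    · obtain ⟨rfl, -⟩ := hadj
      exact eq_true ⟨v, Reachable.rfl⟩
    · obtain ⟨rfl, -⟩ := hadj
      exact (eq_true ⟨u, Reachable.rfl⟩).symm
    · rfl

end glue

/-- `F` is a forest all of whose components meet the image of `ℓ`, and `S` is the partition that
its components induce on the domain of `ℓ`. -/
def InducesForest (F : SimpleGraph W) (ℓ : V → W) (S : Setoid V) : Prop :=
  F.IsAcyclic ∧ (∀ w, ∃ v, F.Reachable w (ℓ v)) ∧ F.reachableSetoid.comap ℓ = S

/-- The graph in which two distinct vertices are adjacent if they are related by `S`. -/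
def ofSetoid (S : Setoid V) : SimpleGraph V := fromRel S

theorem reachableSetoid_ofSetoid (S : Setoid V) : (ofSetoid S).reachableSetoid = S := by
  ext u v
  refine ⟨fun h ↦ Quotient.exact (s := S) ?_, fun h ↦ ?_⟩
  · refine Reachable.eq_of_forall_adj (f := Quotient.mk S) (fun a b hab ↦ Quotient.sound ?_) h
    obtain ⟨-, hab | hab⟩ := hab
    exacts [hab, S.symm hab]
  · by_cases huv : u = v
    · subst huv; exact Reachable.rfl
    · exact Adj.reachable (show (fromRel S).Adj u v from ⟨huv, .inl h⟩)

/-- Adding a new copy of `V` carrying the edges of `H`, joined to the old copy along `Y`, turns a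
forest inducing the partition `S` on the old copy into one inducing `S'` on the new copy. -/
def LayerStep (S : Setoid V) (H : SimpleGraph V) (Y : Set V) (S' : Setoid V) : Prop :=
  (∀ u v, H.Adj u v →
    ¬ (glue (ofSetoid S) id (H.deleteEdges {s(u, v)}) Y).Reachable (.inr u) (.inr v)) ∧
  (∀ v ∈ Y, ¬ (glue (ofSetoid S) id H (Y \ {v})).Reachable (.inl v) (.inr v)) ∧
  (∀ u, ∃ v, (glue (ofSetoid S) id H Y).Reachable (.inl u) (.inr v)) ∧
  (glue (ofSetoid S) id H Y).reachableSetoid.comap Sum.inr = S'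

theorem inducesForest_glue_iff {F : SimpleGraph W} {ℓ : V → W} {S : Setoid V}
    (hF : F.InducesForest ℓ S) {H : SimpleGraph V} {Y : Set V} {S' : Setoid V} :
    (glue F ℓ H Y).InducesForest Sum.inr S' ↔ LayerStep S H Y S' := by
  obtain ⟨hacyc, hreach, hS⟩ := hF
  have hS₀ : F.reachableSetoid.comap ℓ = (ofSetoid S).reachableSetoid.comap id := by
    rw [hS, reachableSetoid_ofSetoid]; rfl
  have key : ∀ (H : SimpleGraph V) (Y : Set V) (x y : V ⊕ V),
      (glue F ℓ H Y).Reachable (x.map ℓ id) (y.map ℓ id) ↔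
        (glue (ofSetoid S) id H Y).Reachable x y := by
    intro H Y x y
    have := @Reachable.glue_congr V V W (ofSetoid S) id H Y F ℓ (fun w ↦ ⟨w, Reachable.rfl⟩)
      hS₀.symm x y
    simp only [Sum.map_id_id, id] at this
    refine ⟨fun h ↦ ?_, this⟩
    simpa using h.glue_congr hreach hS₀
  have hrr H Y u v := key H Y (.inr u) (.inr v)
  have hlr H Y u v := key H Y (.inl u) (.inr v)
  simp only [Sum.map_inl, Sum.map_inr, id] at hrr hlr
  have hcomap : (glue F ℓ H Y).reachableSetoid.comap Sum.inr =
      (glue (ofSetoid S) id H Y).reachableSetoid.comap Sum.inr :=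
    Setoid.ext fun u v ↦ hrr H Y u v
  have hall : (∀ z : W ⊕ V, ∃ v, (glue F ℓ H Y).Reachable z (.inr v)) ↔
      ∀ u, ∃ v, (glue F ℓ H Y).Reachable (.inl (ℓ u)) (.inr v) := by
    refine ⟨fun h u ↦ h _, fun h z ↦ ?_⟩
    rcases z with w | v
    · obtain ⟨u, hu⟩ := hreach w
      obtain ⟨v, hv⟩ := h u
      refine ⟨v, Reachable.trans ?_ hv⟩
      exact hu.map (G' := glue F ℓ H Y) ⟨Sum.inl, fun h ↦ h⟩
    · exact ⟨v, Reachable.rfl⟩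
  rw [InducesForest, LayerStep, isAcyclic_glue_iff hacyc, hcomap, hall]
  simp only [hrr, hlr, and_assoc]

theorem InducesForest.of_glue {F : SimpleGraph W} {ℓ : V → W} {H : SimpleGraph V} {Y : Set V}
    {S' : Setoid V} (h : (glue F ℓ H Y).InducesForest Sum.inr S') :
    F.InducesForest ℓ (F.reachableSetoid.comap ℓ) := by
  refine ⟨?_, fun w ↦ ?_, rfl⟩
  · exact h.1.comap (⟨Sum.inl, fun h ↦ h⟩ : F →g glue F ℓ H Y) Sum.inl_injective
  · obtain ⟨v, hv⟩ := h.2.1 (.inl w)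
    exact exists_reachable_of_glue hv

/-- The number of spanning forests of `K` all of whose components meet the image of `ℓ`, and
whose components induce the partition `S` on the domain of `ℓ`. -/
noncomputable def forestCount (K : SimpleGraph W) (ℓ : V → W) (S : Setoid V) : ℕ :=
  Nat.card {F : SimpleGraph W // F ≤ K ∧ F.InducesForest ℓ S}

/-- The number of ways of adding a new layer, isomorphic to `G`, that turn a forest inducing `S`
on the last layer into one inducing `S'`. -/
noncomputable def layerStepCount (G : SimpleGraph V) (S' S : Setoid V) : ℕ :=
  Nat.card {p : SimpleGraph V × Set V // p.1 ≤ G ∧ LayerStep S p.1 p.2 S'}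

instance [Finite V] : Finite (Setoid V) :=
  Finite.of_injective (fun S u v ↦ S u v) fun _ _ h ↦
    Setoid.ext fun u v ↦ iff_of_eq (congrFun (congrFun h u) v)

theorem forestCount_glue [Finite V] [Finite W] [Fintype (Setoid V)] (K : SimpleGraph W)
    (ℓ : V → W) (G : SimpleGraph V) (S' : Setoid V) :
    forestCount (glue K ℓ G Set.univ) Sum.inr S' =
      ∑ S, layerStepCount G S' S * forestCount K ℓ S := by
  simp only [forestCount, layerStepCount, ← Nat.card_prod, ← Nat.card_sigma]
  refine (Nat.card_congr (Equiv.ofBijective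
    (fun q ↦ ⟨glue q.2.2.1 ℓ q.2.1.1.1 q.2.1.1.2,
      (glue_le_glue_univ_iff _ _ _ _).2 ⟨q.2.2.2.1, q.2.1.2.1⟩,
      (inducesForest_glue_iff q.2.2.2.2).2 q.2.1.2.2⟩) ⟨?_, ?_⟩)).symm
  · rintro ⟨S₁, ⟨⟨H₁, Y₁⟩, h₁⟩, F₁, hF₁⟩ ⟨S₂, ⟨⟨H₂, Y₂⟩, h₂⟩, F₂, hF₂⟩ h
    obtain ⟨rfl, rfl, rfl⟩ := glue_injective (Subtype.ext_iff.1 h)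
    obtain rfl : S₁ = S₂ := hF₁.2.2.2.symm.trans hF₂.2.2.2
    rfl
  · rintro ⟨T, hT, hTS⟩
    have hglue := exists_glue_eq_of_le ℓ hT
    have hF := InducesForest.of_glue (hglue.symm ▸ hTS)
    have hle := (glue_le_glue_univ_iff _ _ _ _).1 (hglue.symm ▸ hT)
    refine ⟨⟨_, ⟨(T.comap Sum.inr, {v | T.Adj (.inl (ℓ v)) (.inr v)}), hle.2,
      (inducesForest_glue_iff hF).1 (hglue.symm ▸ hTS)⟩, T.comap Sum.inl, hle.1, hF⟩, ?_⟩
    exact Subtype.ext hglue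

theorem InducesForest.of_iso {F : SimpleGraph W} {F' : SimpleGraph W'} {ℓ : V → W} {ℓ' : V → W'}
    {S : Setoid V} (e : F ≃g F') (hℓ : ∀ v, e (ℓ v) = ℓ' v) (h : F.InducesForest ℓ S) :
    F'.InducesForest ℓ' S := by
  refine ⟨e.isAcyclic_iff.1 h.1, fun w ↦ ?_, ?_⟩
  · obtain ⟨v, hv⟩ := h.2.1 (e.symm w)
    refine ⟨v, ?_⟩
    rw [← hℓ, ← e.symm_apply_reachable]
    exact hv
  · rw [← h.2.2]
    ext u v
    change F'.Reachable (ℓ' u) (ℓ' v) ↔ F.Reachable (ℓ u) (ℓ v)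
    rw [← hℓ, ← hℓ, e.reachable_iff]

theorem forestCount_congr {K : SimpleGraph W} {K' : SimpleGraph W'} {ℓ : V → W} {ℓ' : V → W'}
    (e : K ≃g K') (hℓ : ∀ v, e (ℓ v) = ℓ' v) (S : Setoid V) :
    forestCount K ℓ S = forestCount K' ℓ' S := by
  have hℓ' : ∀ v, e.symm (ℓ' v) = ℓ v := fun v ↦ by rw [← hℓ, e.symm_apply_apply]
  refine Nat.card_congr
    { toFun F := ⟨F.1.comap e.symm, fun a b hab ↦ ?_,
        F.2.2.of_iso (Iso.comap e.toEquiv.symm F.1).symm hℓ⟩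
      invFun F := ⟨F.1.comap e, fun a b hab ↦ ?_,
        F.2.2.of_iso (Iso.comap e.toEquiv F.1).symm hℓ'⟩
      left_inv F := ?_
      right_inv F := ?_ }
  · exact e.symm.map_adj_iff.1 (F.2.1 hab)
  · exact e.map_adj_iff.1 (F.2.1 hab)
  · ext a b; simp
  · ext a b; simp

theorem spanningTreeCount_eq_forestCount [Nonempty V] (K : SimpleGraph W) (ℓ : V → W) :
    spanningTreeCount K = forestCount K ℓ ⊤ := by
  have htree : ∀ F : SimpleGraph W, F.IsTree ↔ F.InducesForest ℓ ⊤ := by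
    refine fun F ↦ ⟨fun h ↦ ⟨h.isAcyclic, fun w ↦ ?_, ?_⟩, fun ⟨hacyc, hreach, htop⟩ ↦ ?_⟩
    · exact ⟨Classical.arbitrary V, h.connected _ _⟩
    · exact eq_top_iff.2 fun u v _ ↦ h.connected _ _
    · have : Nonempty W := ⟨ℓ (Classical.arbitrary V)⟩
      refine ⟨⟨fun a b ↦ ?_⟩, hacyc⟩
      obtain ⟨u, hu⟩ := hreach a
      obtain ⟨v, hv⟩ := hreach b
      have huv : F.Reachable (ℓ u) (ℓ v) := (Setoid.ext_iff.1 htop u v).2 trivial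
      exact hu.trans (huv.trans hv.symm)
  refine Nat.card_congr
    { toFun H := ⟨H.1.spanningCoe, H.1.spanningCoe_le, (htree _).1
        ((H.1.spanningCoeEquivCoeOfSpanning H.2.1).isTree_iff.2 H.2.2)⟩
      invFun F := ⟨toSubgraph F.1 F.2.1, toSubgraph.isSpanning _ _,
        (Subgraph.spanningCoeEquivCoeOfSpanning _ (toSubgraph.isSpanning _ _)).isTree_iff.1
          ((htree _).2 F.2.2)⟩
      left_inv H := ?_
      right_inv F := ?_ }
  · refine Subtype.ext (Subgraph.ext ?_ ?_)
    · exact (Subgraph.isSpanning_iff.1 H.2.1).symm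
    · rfl
  · rfl

/-- The last layer of `G □ pathGraph (n + 2)` is attached to the layers before it. -/
noncomputable def glueBoxProdPathIso (G : SimpleGraph V) (n : ℕ) :
    glue (G □ pathGraph (n + 1)) (fun v ↦ (v, Fin.last n)) G Set.univ ≃g
      G □ pathGraph (n + 2) where
  toEquiv := Equiv.ofBijective
    (Sum.elim (fun p ↦ (p.1, p.2.castSucc)) fun v ↦ (v, Fin.last (n + 1))) <| by
      refine ⟨?_, ?_⟩
      · rintro (⟨a, i⟩ | a) (⟨b, j⟩ | b) h <;> simp_all [Fin.ext_iff] <;> omega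
      · rintro ⟨v, i⟩
        induction i using Fin.lastCases with
        | last => exact ⟨.inr v, rfl⟩
        | cast i => exact ⟨.inl (v, i), rfl⟩
  map_rel_iff' := by
    rintro (⟨a, i⟩ | a) (⟨b, j⟩ | b) <;>
      simp [boxProd_adj, pathGraph_adj, Fin.ext_iff] <;> grind

theorem forestCount_boxProd_path_succ [Finite V] [Fintype (Setoid V)] (G : SimpleGraph V) (n : ℕ)
    (S' : Setoid V) :
    forestCount (G □ pathGraph (n + 2)) (fun v ↦ (v, Fin.last (n + 1))) S' =
      ∑ S, layerStepCount G S' S *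
        forestCount (G □ pathGraph (n + 1)) (fun v ↦ (v, Fin.last n)) S := by
  rw [← forestCount_glue]
  exact (forestCount_congr (glueBoxProdPathIso G n) (ℓ := Sum.inr) (fun _ ↦ rfl) S').symm

end SimpleGraph

/-- By Cayley–Hamilton, the coordinates of the iterates of a matrix satisfy a linear recurrence. -/
theorem Matrix.linear_recurrence_of_succ_eq_mulVec {R ι : Type*} [CommRing R] [Nontrivial R]
    [Fintype ι] [DecidableEq ι] (M : Matrix ι ι R) (u : ℕ → ι → R)
    (hu : ∀ n, u (n + 1) = M.mulVec (u n)) (n : ℕ) (i : ι) :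
    u (n + Fintype.card ι) i = ∑ j : Fin (Fintype.card ι),
      -M.charpoly.coeff (Fintype.card ι - (j + 1)) * u (n + Fintype.card ι - (j + 1)) i := by
  have hpow : ∀ k, (M ^ k).mulVec (u n) = u (n + k) := by
    intro k
    induction k with
    | zero => simp
    | succ k ih => rw [pow_succ', ← Matrix.mulVec_mulVec, ih, ← add_assoc, hu]
  have hCH := congrFun (congrArg (fun A : Matrix ι ι R ↦ A.mulVec (u n)) M.aeval_self_charpoly) i
  have hlead : M.charpoly.coeff (Fintype.card ι) = 1 := by
    simpa using M.charpoly_monic.coeff_natDegree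
  simp only [Polynomial.aeval_eq_sum_range, M.charpoly_natDegree_eq_dim, Matrix.sum_mulVec,
    Matrix.smul_mulVec, hpow, Matrix.zero_mulVec, Finset.sum_apply, Pi.smul_apply, smul_eq_mul,
    Pi.zero_apply] at hCH
  rw [Finset.sum_range_succ, hlead, one_mul] at hCH
  rw [eq_neg_of_add_eq_zero_right hCH, ← Finset.sum_range_reflect, ← Finset.sum_neg_distrib,
    Finset.sum_range]
  refine Finset.sum_congr rfl fun j _ ↦ ?_
  rw [neg_mul, Nat.sub_sub, add_comm 1, Nat.add_sub_assoc (Nat.succ_le_of_lt j.2)]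

/-- For a graph `G` on `k` vertices, the sequence `T_n` of numbers of spanning trees of
`G □ P_n` satisfies a linear recurrence with integer coefficients of order the Bell number
`B_k` (here `Nat.card (Setoid V)`). -/
theorem spanningTreeCount_boxProd_path_linear_recurrence
    {V : Type*} [Fintype V] (G : SimpleGraph V) :
    ∃ c : Fin (Nat.card (Setoid V)) → ℤ,
      ∀ n : ℕ, 1 ≤ n →
        (spanningTreeCount (G □ pathGraph (n + Nat.card (Setoid V))) : ℤ) =
          ∑ j : Fin (Nat.card (Setoid V)),
            c j * spanningTreeCount (G □ pathGraph (n + Nat.card (Setoid V) - ((j : ℕ) + 1))) := by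
  classical
  have : Fintype (Setoid V) := Fintype.ofFinite _
  rw [Nat.card_eq_fintype_card]
  rcases isEmpty_or_nonempty V with hV | hV
  · have hzero : ∀ m, spanningTreeCount (G □ pathGraph m) = 0 := fun m ↦ by
      have : IsEmpty {H : (G □ pathGraph m).Subgraph // H.IsSpanning ∧ H.coe.IsTree} :=
        ⟨fun H ↦ by
          obtain ⟨x⟩ := H.2.2.connected.nonempty
          exact isEmptyElim x.1.1⟩
      exact Nat.card_of_isEmpty
    exact ⟨0, fun n _ ↦ by simp [hzero]⟩
  · let u : ℕ → Setoid V → ℤ := fun n S ↦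
      forestCount (G □ pathGraph (n + 1)) (fun v ↦ (v, Fin.last n)) S
    let M : Matrix (Setoid V) (Setoid V) ℤ := fun S' S ↦ layerStepCount G S' S
    have hu : ∀ n, u (n + 1) = M.mulVec (u n) := fun n ↦ by
      ext S'
      simp only [u, M, forestCount_boxProd_path_succ, Matrix.mulVec, dotProduct]
      push_cast
      rfl
    have hT : ∀ m, 1 ≤ m → (spanningTreeCount (G □ pathGraph m) : ℤ) = u (m - 1) ⊤ := by
      rintro (_ | m) hm
      · omega
      · exact congrArg _ (spanningTreeCount_eq_forestCount _ _)
    refine ⟨fun j ↦ -M.charpoly.coeff (Fintype.card (Setoid V) - (j + 1)), fun n hn ↦ ?_⟩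
    obtain ⟨n, rfl⟩ := Nat.exists_eq_add_of_le' hn
    rw [hT _ (by omega), show n + 1 + Fintype.card (Setoid V) - 1 = n + Fintype.card (Setoid V) by
      omega, M.linear_recurrence_of_succ_eq_mulVec u hu]
    refine Finset.sum_congr rfl fun j _ ↦ ?_
    rw [hT _ (by omega)]
    congr 2
    omega
end

section
/- Let G be a finite simple graph on k vertices, let B_{2k} denote the 2k-th Bell number, and let T_n denote the number of spanning trees of G □ C_n. Then (T_n) satisfies a linear recurrence with integer coefficients of order at most B_{2k}: there exist m ≤ B_{2k} and integers c_1, …, c_m such that for all n ≥ 3, T_{n + m} = c_1·T_{n + m − 1} + c_2·T_{n + m − 2} + … + c_m·T_n. -/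
open SimpleGraph

/-- The shift operator on integer sequences. -/
def sequenceShift : (ℕ → ℤ) →ₗ[ℤ] (ℕ → ℤ) := LinearMap.funLeft ℤ ℤ Nat.succ

lemma sequenceShift_pow_apply (s : ℕ → ℤ) (a n : ℕ) :
    (sequenceShift ^ a) s n = s (a + n) := by
  induction a generalizing n with
  | zero => simp
  | succ a ih =>
    rw [pow_succ', Module.End.mul_apply]
    change (sequenceShift ^ a) s (n + 1) = _
    rw [ih]
    congr 1
    omega

/-- An integer sequence whose Hankel matrix factors through a finite index type `ι` satisfies an
integral linear recurrence of order at most the cardinality of `ι`. -/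
theorem exists_linear_recurrence_of_hankel_factorization {ι : Type*} [Fintype ι]
    (s : ℕ → ℤ) (f g : ι → ℕ → ℤ) (h : ∀ a n, s (a + n) = ∑ i, f i a * g i n) :
    ∃ m ≤ Fintype.card ι, ∃ c : Fin m → ℤ,
      ∀ n, s (n + m) = ∑ j : Fin m, c j * s (n + m - ((j : ℕ) + 1)) := by
  let M : Submodule ℤ (ℕ → ℤ) := Submodule.span ℤ (Set.range fun a => (sequenceShift ^ a) s)
  let N : Submodule ℤ (ℕ → ℤ) := Submodule.span ℤ (Set.range g)
  have hMN : M ≤ N := by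
    refine Submodule.span_le.2 ?_
    rintro _ ⟨a, rfl⟩
    have : (sequenceShift ^ a) s = ∑ i, f i a • g i := by
      ext n
      simp [sequenceShift_pow_apply, h]
    change (sequenceShift ^ a) s ∈ N
    rw [this]
    exact Submodule.sum_mem _ fun i _ =>
      Submodule.smul_mem _ _ (Submodule.subset_span ⟨i, rfl⟩)
  have : Module.Finite ℤ N := Module.Finite.span_of_finite ℤ (Set.finite_range g)
  have : Module.Finite ℤ M := Module.Finite.of_injective _ (Submodule.inclusion_injective hMN)
  have hm : Module.finrank ℤ M ≤ Fintype.card ι :=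
    (Submodule.finrank_mono hMN).trans (finrank_range_le_card g)
  have hs : s ∈ M := Submodule.subset_span ⟨0, by simp⟩
  have hshift : ∀ x ∈ M, sequenceShift x ∈ M := by
    intro x hx
    have : M ≤ M.comap sequenceShift := by
      refine Submodule.span_le.2 ?_
      rintro _ ⟨a, rfl⟩
      refine Submodule.subset_span ⟨a + 1, ?_⟩
      simp [pow_succ']
    exact this hx
  let φ : Module.End ℤ M := sequenceShift.restrict hshift
  have hφ : ∀ a, (((φ ^ a) ⟨s, hs⟩ : M) : ℕ → ℤ) = (sequenceShift ^ a) s := by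
    intro a
    induction a with
    | zero => simp
    | succ a ih => rw [pow_succ', pow_succ', Module.End.mul_apply, Module.End.mul_apply, ← ih]; rfl
  let p := φ.charpoly
  have hdeg : p.natDegree = Module.finrank ℤ M := φ.charpoly_natDegree
  have hmonic : p.coeff (Module.finrank ℤ M) = 1 := by
    rw [← hdeg]; exact φ.charpoly_monic
  refine ⟨Module.finrank ℤ M, hm, fun j => - p.coeff (Module.finrank ℤ M - (j + 1)), fun n => ?_⟩
  have h0 : Polynomial.aeval φ p ⟨s, hs⟩ = 0 := by
    rw [LinearMap.aeval_self_charpoly]; rfl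
  rw [Polynomial.aeval_eq_sum_range, hdeg, LinearMap.sum_apply] at h0
  have h1 := congrFun (congrArg (Subtype.val) h0) n
  simp only [Submodule.coe_sum, LinearMap.smul_apply, Submodule.coe_smul, hφ,
    Finset.sum_apply, Pi.smul_apply, sequenceShift_pow_apply, smul_eq_mul,
    ZeroMemClass.coe_zero, Pi.zero_apply] at h1
  rw [Finset.sum_range_succ, hmonic, one_mul, ← Finset.sum_range_reflect] at h1
  rw [add_comm n, eq_neg_of_add_eq_zero_right h1, Finset.sum_range, ← Finset.sum_neg_distrib]
  refine Finset.sum_congr rfl fun j _ => ?_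
  rw [neg_mul]
  have := j.2
  rw [show Module.finrank ℤ M - 1 - j = Module.finrank ℤ M - (j + 1) by omega,
    show Module.finrank ℤ M - (j + 1) + n = Module.finrank ℤ M + n - (j + 1) by omega]

namespace CyclicWord

section
variable {V E : Type*}

/-- The letter `l` describes the edges from one layer `p` of a coloring to the next layer `q`:
an element `inl e` is an edge `e` inside the layer of `p`, and `inr x` joins the two copies
of `x`. The colors are compatible with `l` if they agree along each of these edges. -/
def Compatible (ends : E → Sym2 V) (l : Finset (E ⊕ V)) (p q : V → Prop) : Prop :=
  (∀ e, Sum.inl e ∈ l → ∀ x ∈ ends e, ∀ y ∈ ends e, p x = p y) ∧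
    ∀ x, Sum.inr x ∈ l → p x = q x

/-- A two-coloring of consecutive layers that is constant along the edges given by a word. -/
def IsColoring (ends : E → Sym2 V) {n : ℕ} (w : Fin n → Finset (E ⊕ V)) (c : ℕ → V → Prop) :
    Prop :=
  ∀ i : Fin n, Compatible ends (w i) (c i) (c (i + 1))

/-- The graph obtained from a word by identifying its first and last layers is connected (or
empty): every periodic coloring is constant. -/
def CyclicallyConnected (ends : E → Sym2 V) {n : ℕ} (w : Fin n → Finset (E ⊕ V)) : Prop :=
  ∀ c, IsColoring ends w c → c n = c 0 → ∃ t : Prop, ∀ i ≤ n, ∀ x, c i x = t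

/-- The number of edges given by a word. -/
def size {n : ℕ} (w : Fin n → Finset (E ⊕ V)) : ℕ := ∑ i, (w i).card

/-- The words whose associated cyclic graph is a tree. -/
def IsTreeWord (ends : E → Sym2 V) {n : ℕ} (w : Fin n → Finset (E ⊕ V)) : Prop :=
  CyclicallyConnected ends w ∧ size w + 1 = Nat.card V * n

/-- The colors of the first and last layers. -/
def boundary (n : ℕ) (c : ℕ → V → Prop) : V ⊕ V → Prop := Sum.elim (c 0) (c n)

/-- Two boundary vertices are related if all colorings agree on them. -/
def boundarySetoid (ends : E → Sym2 V) {n : ℕ} (w : Fin n → Finset (E ⊕ V)) : Setoid (V ⊕ V) where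
  r x y := ∀ c, IsColoring ends w c → boundary n c x = boundary n c y
  iseqv := ⟨fun _ _ _ => rfl, fun h c hc => (h c hc).symm,
    fun h h' c hc => (h c hc).trans (h' c hc)⟩

variable {ends : E → Sym2 V}

lemma size_append {a b : ℕ} (u : Fin a → Finset (E ⊕ V)) (v : Fin b → Finset (E ⊕ V)) :
    size (Fin.append u v) = size u + size v := by
  simp [size, Fin.sum_univ_add]

lemma isColoring_append {a b : ℕ} {u : Fin a → Finset (E ⊕ V)} {v : Fin b → Finset (E ⊕ V)}
    {c : ℕ → V → Prop} :
    IsColoring ends (Fin.append u v) c ↔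
      IsColoring ends u c ∧ IsColoring ends v (fun i => c (a + i)) := by
  simp [IsColoring, Fin.forall_fin_add, add_assoc]

/-- Glue a coloring of the first `a` layers with a coloring of the following ones. -/
def glue (a : ℕ) (c d : ℕ → V → Prop) (i : ℕ) : V → Prop :=
  if i ≤ a then c i else d (i - a)

lemma glue_of_le {a i : ℕ} (c d : ℕ → V → Prop) (h : i ≤ a) : glue a c d i = c i := if_pos h

lemma glue_add {a : ℕ} {c d : ℕ → V → Prop} (h : d 0 = c a) (i : ℕ) :
    glue a c d (a + i) = d i := by
  rcases i with _ | i
  · simp [glue, h]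
  · simp [glue]

lemma isColoring_glue {a b : ℕ} {u : Fin a → Finset (E ⊕ V)} {v : Fin b → Finset (E ⊕ V)}
    {c d : ℕ → V → Prop} (hc : IsColoring ends u c) (hd : IsColoring ends v d)
    (h : d 0 = c a) : IsColoring ends (Fin.append u v) (glue a c d) := by
  rw [isColoring_append]
  constructor
  · intro i
    rw [glue_of_le c d i.2.le, glue_of_le c d i.2]
    exact hc i
  · simpa only [glue_add h] using hd

lemma exists_isColoring_of_boundarySetoid_eq {a b : ℕ} {u : Fin a → Finset (E ⊕ V)}
    {v : Fin b → Finset (E ⊕ V)} (h : boundarySetoid ends u = boundarySetoid ends v)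
    {c : ℕ → V → Prop} (hc : IsColoring ends u c) :
    ∃ d, IsColoring ends v d ∧ d 0 = c 0 ∧ d b = c a := by
  have key : ∀ y, (∃ z, boundary a c z ∧
      ∀ d, IsColoring ends v d → boundary b d y = boundary b d z) = boundary a c y := by
    intro y
    refine propext ⟨?_, fun hy => ⟨y, hy, fun _ _ => rfl⟩⟩
    rintro ⟨z, hz, hyz⟩
    have : (boundarySetoid ends u).r y z := by rw [h]; exact hyz
    rwa [this c hc]
  refine ⟨fun i x => ∃ z, boundary a c z ∧
    ∀ d, IsColoring ends v d → d i x = boundary b d z, ?_, ?_, ?_⟩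
  · refine fun i => ⟨fun e he x hx y hy => ?_, fun x hx => ?_⟩
    · have : ∀ d, IsColoring ends v d → d i x = d i y := fun d hd => (hd i).1 e he x hx y hy
      simp +contextual only [this]
    · have : ∀ d, IsColoring ends v d → d i x = d (i + 1) x := fun d hd => (hd i).2 x hx
      simp +contextual only [this]
  · exact funext fun x => key (Sum.inl x)
  · exact funext fun x => key (Sum.inr x)

lemma cyclicallyConnected_append_exchange {a a' b b' : ℕ} {u : Fin a → Finset (E ⊕ V)}
    {u' : Fin a' → Finset (E ⊕ V)} {v : Fin b → Finset (E ⊕ V)} {v' : Fin b' → Finset (E ⊕ V)}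
    (h : boundarySetoid ends u = boundarySetoid ends u')
    (huv : CyclicallyConnected ends (Fin.append u v))
    (huv' : CyclicallyConnected ends (Fin.append u' v')) :
    CyclicallyConnected ends (Fin.append u' v) := by
  intro c hc hper
  obtain ⟨hcu, hcv⟩ := isColoring_append.1 hc
  obtain ⟨d, hd, hd0, hda⟩ := exists_isColoring_of_boundarySetoid_eq h.symm hcu
  obtain ⟨t, ht⟩ := huv _ (isColoring_glue hd hcv (by simpa using hda.symm))
    (by rw [glue_add (by simpa using hda.symm), glue_of_le _ _ (Nat.zero_le _), hd0, hper])
  have hv : ∀ i ≤ b, ∀ x, c (a' + i) x = t := by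
    intro i hi x
    rw [← ht (a + i) (by omega) x, glue_add (by simpa using hda.symm)]
  obtain ⟨t', ht'⟩ := huv' _ (isColoring_glue (d := fun _ _ => t) hcu
      (fun i => ⟨fun _ _ _ _ _ _ => rfl, fun _ _ => rfl⟩)
      (funext fun x => (hv 0 (Nat.zero_le _) x).symm))
    (by
      rw [glue_add (funext fun x => (hv 0 (Nat.zero_le _) x).symm),
        glue_of_le _ _ (Nat.zero_le _), ← hper]
      exact funext fun x => (hv b le_rfl x).symm)
  have hu : ∀ i ≤ a', ∀ x, c i x = t' := by
    intro i hi x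
    rw [← ht' i (by omega) x, glue_of_le _ _ hi]
  refine ⟨t, fun i hi x => ?_⟩
  rcases le_total i a' with hia | hia
  · rw [hu i hia, ← hu a' le_rfl x]
    exact hv 0 (Nat.zero_le _) x
  · obtain ⟨j, rfl⟩ := Nat.exists_eq_add_of_le hia
    exact hv j (by omega) x

end

section
variable {V : Type*} {G : SimpleGraph V}

/-- The endpoints of an edge of `G □ C_n`. -/
def boxProdEnds (n : ℕ) : (Σ _ : Fin (n + 3), G.edgeSet ⊕ V) → Sym2 (V × Fin (n + 3))
  | ⟨i, Sum.inl e⟩ => e.1.map fun x => (x, i)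
  | ⟨i, Sum.inr x⟩ => s((x, i), (x, i + 1))

lemma fin_add_one_add_one_ne (n : ℕ) (i : Fin (n + 3)) : i + 1 + 1 ≠ i := by
  rw [add_assoc, ne_eq, add_eq_left, Fin.ext_iff, Fin.val_add]
  simp [Nat.mod_eq_of_lt (show 2 < n + 3 by omega)]

lemma boxProdEnds_injective (n : ℕ) : Function.Injective (boxProdEnds (G := G) n) := by
  rintro ⟨i, ⟨e, he⟩ | x⟩ ⟨j, ⟨e', he'⟩ | y⟩ h
  · induction e with | h a b
    induction e' with | h a' b'
    simp only [boxProdEnds, Sym2.map_mk, Sym2.eq_iff, Prod.mk.injEq] at h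
    obtain ⟨⟨rfl, rfl⟩, rfl, -⟩ | ⟨⟨rfl, rfl⟩, rfl, -⟩ := h
    · rfl
    · simp [Sym2.eq_swap]
  · induction e with | h a b
    simp only [boxProdEnds, Sym2.map_mk, Sym2.eq_iff, Prod.mk.injEq] at h
    obtain ⟨⟨rfl, rfl⟩, rfl, -⟩ | ⟨⟨rfl, rfl⟩, rfl, -⟩ := h <;> simp at he
  · induction e' with | h a b
    simp only [boxProdEnds, Sym2.map_mk, Sym2.eq_iff, Prod.mk.injEq] at h
    obtain ⟨⟨rfl, rfl⟩, rfl, -⟩ | ⟨⟨rfl, rfl⟩, rfl, -⟩ := h <;> simp at he'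
  · simp only [boxProdEnds, Sym2.eq_iff, Prod.mk.injEq] at h
    obtain ⟨⟨rfl, rfl⟩, -⟩ | ⟨⟨rfl, rfl⟩, -, h⟩ := h
    · rfl
    · exact absurd h (fin_add_one_add_one_ne n j)

lemma range_boxProdEnds (n : ℕ) :
    Set.range (boxProdEnds (G := G) n) = (G □ cycleGraph (n + 3)).edgeSet := by
  ext z
  induction z with | h p q
  obtain ⟨x, i⟩ := p
  obtain ⟨y, j⟩ := q
  simp only [Set.mem_range, mem_edgeSet, boxProd_adj, cycleGraph_adj]
  constructor
  · rintro ⟨⟨k, ⟨e, he⟩ | v⟩, h⟩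
    · induction e with | h a b
      simp only [boxProdEnds, Sym2.map_mk, Sym2.eq_iff, Prod.mk.injEq] at h
      obtain ⟨⟨rfl, rfl⟩, rfl, rfl⟩ | ⟨⟨rfl, rfl⟩, rfl, rfl⟩ := h
      · exact Or.inl ⟨he, rfl⟩
      · exact Or.inl ⟨(G.mem_edgeSet.1 he).symm, rfl⟩
    · simp only [boxProdEnds, Sym2.eq_iff, Prod.mk.injEq] at h
      obtain ⟨⟨rfl, rfl⟩, rfl, rfl⟩ | ⟨⟨rfl, rfl⟩, rfl, rfl⟩ := h
      · exact Or.inr ⟨Or.inr (by simp), rfl⟩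
      · exact Or.inr ⟨Or.inl (by simp), rfl⟩
  · rintro (⟨h, rfl⟩ | ⟨h | h, rfl⟩)
    · exact ⟨⟨i, Sum.inl ⟨s(x, y), h⟩⟩, rfl⟩
    · obtain rfl := sub_eq_iff_eq_add'.1 h
      exact ⟨⟨j, Sum.inr x⟩, by simp [boxProdEnds, Sym2.eq_swap]⟩
    · obtain rfl := sub_eq_iff_eq_add'.1 h
      exact ⟨⟨i, Sum.inr x⟩, by simp [boxProdEnds]⟩

/-- The spanning subgraph of `G □ C_n` given by a word. -/
def toSimpleGraph {n : ℕ} (w : Fin (n + 3) → Finset (G.edgeSet ⊕ V)) :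
    SimpleGraph (V × Fin (n + 3)) :=
  fromEdgeSet (boxProdEnds n '' {z | z.2 ∈ w z.1})

lemma edgeSet_toSimpleGraph {n : ℕ} (w : Fin (n + 3) → Finset (G.edgeSet ⊕ V)) :
    (toSimpleGraph w).edgeSet = boxProdEnds n '' {z | z.2 ∈ w z.1} := by
  rw [toSimpleGraph, edgeSet_fromEdgeSet, sdiff_eq_left, Set.disjoint_left]
  rintro _ ⟨z, -, rfl⟩
  have : boxProdEnds n z ∈ (G □ cycleGraph (n + 3)).edgeSet := by
    rw [← range_boxProdEnds]; exact ⟨z, rfl⟩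
  exact not_isDiag_of_mem_edgeSet _ this

lemma toSimpleGraph_le {n : ℕ} (w : Fin (n + 3) → Finset (G.edgeSet ⊕ V)) :
    toSimpleGraph w ≤ G □ cycleGraph (n + 3) := by
  rw [← edgeSet_subset_edgeSet, edgeSet_toSimpleGraph, ← range_boxProdEnds]
  exact Set.image_subset_range _ _

lemma card_edgeSet_toSimpleGraph {n : ℕ} (w : Fin (n + 3) → Finset (G.edgeSet ⊕ V)) :
    Nat.card (toSimpleGraph w).edgeSet = size w := by
  rw [edgeSet_toSimpleGraph, Nat.card_image_of_injective (boxProdEnds_injective n)]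
  have : ({z | z.2 ∈ w z.1} : Set (Σ _ : Fin (n + 3), G.edgeSet ⊕ V)) =
      (Finset.univ.sigma w : Finset _) := by
    ext z
    simp
  rw [this, Nat.card_coe_set_eq, Set.ncard_coe_finset, Finset.card_sigma, size]

lemma toSimpleGraph_injective (n : ℕ) :
    Function.Injective (toSimpleGraph (G := G) (n := n)) := by
  intro w w' h
  have h := congrArg SimpleGraph.edgeSet h
  rw [edgeSet_toSimpleGraph, edgeSet_toSimpleGraph,
    (boxProdEnds_injective n).image_injective.eq_iff] at h
  ext i e
  exact Set.ext_iff.1 h ⟨i, e⟩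

lemma exists_toSimpleGraph_eq [Finite V] {n : ℕ} {H : SimpleGraph (V × Fin (n + 3))}
    (hH : H ≤ G □ cycleGraph (n + 3)) :
    ∃ w : Fin (n + 3) → Finset (G.edgeSet ⊕ V), toSimpleGraph w = H := by
  classical
  have := Fintype.ofFinite (G.edgeSet ⊕ V)
  refine ⟨fun i => {e | boxProdEnds n ⟨i, e⟩ ∈ H.edgeSet}, ?_⟩
  rw [← edgeSet_inj, edgeSet_toSimpleGraph]
  ext z
  constructor
  · rintro ⟨e, he, rfl⟩
    simpa using he
  · intro hz
    obtain ⟨e, rfl⟩ := (range_boxProdEnds (G := G) n).symm ▸ edgeSet_mono hH hz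
    exact ⟨e, by simpa using hz, rfl⟩

lemma toSimpleGraph_adj_of_inl {n : ℕ} {w : Fin (n + 3) → Finset (G.edgeSet ⊕ V)}
    {i : Fin (n + 3)} {x y : V} (hxy : s(x, y) ∈ G.edgeSet) (h : Sum.inl ⟨s(x, y), hxy⟩ ∈ w i) :
    (toSimpleGraph w).Adj (x, i) (y, i) := by
  rw [← mem_edgeSet, edgeSet_toSimpleGraph]
  exact ⟨⟨i, Sum.inl ⟨s(x, y), hxy⟩⟩, by simpa using h, rfl⟩

lemma toSimpleGraph_adj_of_inr {n : ℕ} {w : Fin (n + 3) → Finset (G.edgeSet ⊕ V)}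
    {i : Fin (n + 3)} {x : V} (h : Sum.inr x ∈ w i) :
    (toSimpleGraph w).Adj (x, i) (x, i + 1) := by
  rw [← mem_edgeSet, edgeSet_toSimpleGraph]
  exact ⟨⟨i, Sum.inr x⟩, by simpa using h, rfl⟩

lemma CyclicallyConnected.preconnected {n : ℕ} {w : Fin (n + 3) → Finset (G.edgeSet ⊕ V)}
    (h : CyclicallyConnected Subtype.val w) : (toSimpleGraph w).Preconnected := by
  intro p q
  have hcol : IsColoring Subtype.val w
      (fun i x => (toSimpleGraph w).Reachable p (x, Fin.ofNat (n + 3) i)) := by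
    intro i
    simp only [Fin.ofNat_eq_cast, Fin.cast_val_eq_self]
    constructor
    · rintro ⟨e, he⟩ hmem x hx y hy
      induction e with | h a b
      have hab := (toSimpleGraph_adj_of_inl he hmem).reachable
      have hiff := propext (⟨fun h => h.trans hab, fun h => h.trans hab.symm⟩ :
        (toSimpleGraph w).Reachable p (a, i) ↔ (toSimpleGraph w).Reachable p (b, i))
      simp only [Sym2.mem_iff] at hx hy
      rcases hx with rfl | rfl <;> rcases hy with rfl | rfl <;> simp [hiff]
    · intro x hx
      have hab := (toSimpleGraph_adj_of_inr hx).reachable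
      exact propext ⟨fun h => h.trans hab, fun h => h.trans hab.symm⟩
  obtain ⟨t, ht⟩ := h _ hcol (by simp)
  have hp := ht p.2 p.2.2.le p.1
  have hq := ht q.2 q.2.2.le q.1
  simp only [Fin.ofNat_eq_cast, Fin.cast_val_eq_self, Prod.mk.eta] at hp hq
  rw [hq, ← hp]

lemma cyclicallyConnected_of_preconnected {n : ℕ} {w : Fin (n + 3) → Finset (G.edgeSet ⊕ V)}
    (h : (toSimpleGraph w).Preconnected) : CyclicallyConnected Subtype.val w := by
  intro c hc hper
  have hsucc : ∀ (i : Fin (n + 3)) (x : V), c (i + 1 : Fin (n + 3)) x = c (i + 1 : ℕ) x := by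
    intro i x
    by_cases hi : i = Fin.last (n + 2)
    · subst hi
      simp [hper]
    · rw [Fin.val_add_one_of_lt (Fin.lt_last_iff_ne_last.2 hi)]
  have hadj : ∀ p q : V × Fin (n + 3), (toSimpleGraph w).Adj p q → c p.2 p.1 = c q.2 q.1 := by
    rintro ⟨x, i⟩ ⟨y, j⟩ hpq
    rw [← mem_edgeSet, edgeSet_toSimpleGraph] at hpq
    obtain ⟨⟨k, ⟨e, he⟩ | v⟩, hk, h⟩ := hpq
    · induction e with | h a b
      have hab : c k a = c k b := (hc k).1 ⟨s(a, b), he⟩ (by simpa using hk) a (by simp) b (by simp)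
      simp only [boxProdEnds, Sym2.map_mk, Sym2.eq_iff, Prod.mk.injEq] at h
      obtain ⟨⟨rfl, rfl⟩, rfl, rfl⟩ | ⟨⟨rfl, rfl⟩, rfl, rfl⟩ := h
      · exact hab
      · exact hab.symm
    · have hab : c k v = c (k + 1 : ℕ) v := (hc k).2 v (by simpa using hk)
      rw [← hsucc] at hab
      simp only [boxProdEnds, Sym2.eq_iff, Prod.mk.injEq] at h
      obtain ⟨⟨rfl, rfl⟩, rfl, rfl⟩ | ⟨⟨rfl, rfl⟩, rfl, rfl⟩ := h
      · exact hab
      · exact hab.symm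
  have hreach : ∀ p q : V × Fin (n + 3), c p.2 p.1 = c q.2 q.1 := by
    intro p q
    obtain ⟨W⟩ := h p q
    induction W with
    | nil => rfl
    | cons hh _ ih => exact (hadj _ _ hh).trans ih
  rcases isEmpty_or_nonempty V with hV | ⟨⟨x₀⟩⟩
  · exact ⟨True, fun _ _ x => isEmptyElim x⟩
  · refine ⟨c 0 x₀, fun i hi x => ?_⟩
    rcases hi.eq_or_lt with rfl | hi
    · rw [hper]
      exact hreach (x, 0) (x₀, 0)
    · exact hreach (x, ⟨i, hi⟩) (x₀, 0)

lemma isTree_toSimpleGraph_iff [Finite V] {n : ℕ} {w : Fin (n + 3) → Finset (G.edgeSet ⊕ V)} :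
    (toSimpleGraph w).IsTree ↔ IsTreeWord Subtype.val w := by
  rw [isTree_iff_connected_and_card, card_edgeSet_toSimpleGraph, Nat.card_prod, Nat.card_fin,
    IsTreeWord, connected_iff]
  constructor
  · rintro ⟨⟨h, -⟩, h'⟩
    exact ⟨cyclicallyConnected_of_preconnected h, h'⟩
  · rintro ⟨h, h'⟩
    refine ⟨⟨h.preconnected, ?_⟩, h'⟩
    have hpos : 0 < Nat.card V := Nat.pos_of_ne_zero fun h0 => by simp [h0] at h'
    have := (Nat.card_pos_iff.1 hpos).1
    infer_instance

lemma CyclicallyConnected.card_mul_le [Finite V] {n : ℕ} (hn : 3 ≤ n)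
    {w : Fin n → Finset (G.edgeSet ⊕ V)} (h : CyclicallyConnected Subtype.val w) :
    Nat.card V * n ≤ size w + 1 := by
  obtain ⟨n, rfl⟩ := Nat.exists_eq_add_of_le' hn
  rcases isEmpty_or_nonempty V with hV | hV
  · simp
  · have hc : (toSimpleGraph w).Connected := ⟨h.preconnected⟩
    have := hc.card_vert_le_card_edgeSet_add_one
    rwa [card_edgeSet_toSimpleGraph, Nat.card_prod, Nat.card_fin] at this

lemma isTreeWord_append_exchange [Finite V] {a a' b b' : ℕ}
    {u : Fin a → Finset (G.edgeSet ⊕ V)} {u' : Fin a' → Finset (G.edgeSet ⊕ V)}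
    {v : Fin b → Finset (G.edgeSet ⊕ V)} {v' : Fin b' → Finset (G.edgeSet ⊕ V)}
    (hab : 3 ≤ a' + b) (hab' : 3 ≤ a + b')
    (h : boundarySetoid Subtype.val u = boundarySetoid Subtype.val u')
    (huv : IsTreeWord Subtype.val (Fin.append u v))
    (huv' : IsTreeWord Subtype.val (Fin.append u' v')) :
    IsTreeWord Subtype.val (Fin.append u' v) := by
  have hc := cyclicallyConnected_append_exchange h huv.1 huv'.1
  have hc' := cyclicallyConnected_append_exchange h.symm huv'.1 huv.1
  refine ⟨hc, ?_⟩
  have h₁ := hc.card_mul_le hab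
  have h₂ := hc'.card_mul_le hab'
  have h₃ := huv.2
  have h₄ := huv'.2
  simp only [size_append, mul_add] at h₁ h₂ h₃ h₄ ⊢
  omega

theorem card_isTreeWord [Finite V] (n : ℕ) :
    Nat.card {w : Fin (n + 3) → Finset (G.edgeSet ⊕ V) // IsTreeWord Subtype.val w} =
      spanningTreeCount (G □ cycleGraph (n + 3)) := by
  have hspan (H : (G □ cycleGraph (n + 3)).Subgraph) (hH : H.IsSpanning) :
      H.coe.IsTree ↔ H.spanningCoe.IsTree :=
    (H.spanningCoeEquivCoeOfSpanning hH).isTree_iff.symm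
  refine Nat.card_eq_of_bijective
    (fun w => ⟨SimpleGraph.toSubgraph (toSimpleGraph w.1) (toSimpleGraph_le w.1),
      toSubgraph.isSpanning _ _,
      (hspan _ (toSubgraph.isSpanning _ _)).2 (isTree_toSimpleGraph_iff.2 w.2)⟩) ⟨?_, ?_⟩
  · intro w w' h
    refine Subtype.ext (toSimpleGraph_injective n ?_)
    exact congrArg (fun H => H.1.spanningCoe) h
  · rintro ⟨H, hH, hT⟩
    obtain ⟨w, hw⟩ := exists_toSimpleGraph_eq H.spanningCoe_le
    refine ⟨⟨w, isTree_toSimpleGraph_iff.1 (hw ▸ (hspan H hH).1 hT)⟩, Subtype.ext ?_⟩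
    refine Subgraph.ext ?_ ?_
    · exact (Subgraph.isSpanning_iff.1 hH).symm
    · change (toSimpleGraph w).Adj = _
      rw [hw]
      rfl

/-- Cutting a cyclic word into two pieces of lengths `a + 1` and `b + 2` factors the number of
tree words through the partitions of the boundary. -/
theorem card_isTreeWord_add [Finite V] [Fintype (Setoid (V ⊕ V))] (a b : ℕ) :
    Nat.card {w : Fin (a + 1 + (b + 2)) → Finset (G.edgeSet ⊕ V) // IsTreeWord Subtype.val w} =
      ∑ r : Setoid (V ⊕ V),
        Nat.card {u : Fin (a + 1) → Finset (G.edgeSet ⊕ V) // boundarySetoid Subtype.val u = r ∧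
          ∃ (b' : ℕ) (v' : Fin (b' + 2) → Finset (G.edgeSet ⊕ V)),
            IsTreeWord Subtype.val (Fin.append u v')} *
        Nat.card {v : Fin (b + 2) → Finset (G.edgeSet ⊕ V) //
          ∃ (a' : ℕ) (u' : Fin (a' + 1) → Finset (G.edgeSet ⊕ V)),
            boundarySetoid Subtype.val u' = r ∧ IsTreeWord Subtype.val (Fin.append u' v)} := by
  simp only [← Nat.card_prod]
  rw [← Nat.card_sigma]
  symm
  refine Nat.card_eq_of_bijective (fun z => ⟨Fin.append z.2.1.1 z.2.2.1, ?_⟩) ⟨?_, ?_⟩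
  · obtain ⟨r, ⟨u, rfl, b', v', h'⟩, v, a', u', hr, h⟩ := z
    exact isTreeWord_append_exchange (by omega) (by omega) hr h h'
  · rintro ⟨r, ⟨u, rfl, hu⟩, v, hv⟩ ⟨r', ⟨u', rfl, hu'⟩, v', hv'⟩ h
    have h := (Fin.appendEquiv (a + 1) (b + 2)).injective (a₁ := (u, v)) (a₂ := (u', v'))
      (congrArg Subtype.val h)
    obtain ⟨rfl, rfl⟩ := Prod.mk.inj h
    rfl
  · rintro ⟨w, hw⟩
    obtain ⟨⟨u, v⟩, rfl⟩ := (Fin.appendEquiv (a + 1) (b + 2)).surjective w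
    exact ⟨⟨_, ⟨u, rfl, b, v, hw⟩, v, a, u, rfl, hw⟩, rfl⟩

end

end CyclicWord

lemma finite_setoid (α : Type*) [Finite α] : Finite (Setoid α) :=
  Finite.of_injective (fun r : Setoid α => r.r) fun _ _ h =>
    Setoid.ext fun a b => iff_of_eq (congrFun (congrFun h a) b)

/-- For a graph `G` on `k` vertices, the sequence `T_n` of numbers of spanning trees of
`G □ C_n` satisfies a linear recurrence with integer coefficients of order at most the
Bell number `B_{2k}` (here `Nat.card (Setoid (Fin (2 * k)))`). -/
theorem spanningTreeCount_boxProd_cycle_linear_recurrence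
    {V : Type*} [Fintype V] (G : SimpleGraph V) (k : ℕ) (hk : Fintype.card V = k) :
    ∃ m : ℕ, m ≤ Nat.card (Setoid (Fin (2 * k))) ∧
      ∃ c : Fin m → ℤ,
        ∀ n : ℕ, 3 ≤ n →
          (spanningTreeCount (G □ cycleGraph (n + m)) : ℤ) =
            ∑ j : Fin m,
              c j * spanningTreeCount (G □ cycleGraph (n + m - ((j : ℕ) + 1))) := by
  have := finite_setoid (V ⊕ V)
  have := finite_setoid (Fin (2 * k))
  have := Fintype.ofFinite (Setoid (V ⊕ V))
  obtain ⟨m, hm, c, hc⟩ := exists_linear_recurrence_of_hankel_factorization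
    (fun n => (spanningTreeCount (G □ cycleGraph (n + 3)) : ℤ)) _ _ (fun a b => by
      rw [← CyclicWord.card_isTreeWord, show a + b + 3 = a + 1 + (b + 2) by ring,
        CyclicWord.card_isTreeWord_add a b, Nat.cast_sum]
      simp only [Nat.cast_mul]
      rfl)
  refine ⟨m, hm.trans ?_, c, fun n hn => ?_⟩
  · rw [← Nat.card_eq_fintype_card]
    have e : Fin (2 * k) ≃ V ⊕ V := (Fintype.equivFinOfCardEq (by simp [hk, two_mul])).symm
    refine Nat.card_le_card_of_injective (Setoid.comap e) fun r s h => Setoid.ext fun x y => ?_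
    simpa [Setoid.comap_rel] using Setoid.ext_iff.1 h (e.symm x) (e.symm y)
  · obtain ⟨n, rfl⟩ := Nat.exists_eq_add_of_le' hn
    have h := hc n
    rw [show n + 3 + m = n + m + 3 by ring]
    refine h.trans (Finset.sum_congr rfl fun j _ => ?_)
    have := j.2
    rw [show n + m - (j + 1) + 3 = n + m + 3 - (j + 1) by omega]
end

section
/- Let T_n denote the number of spanning trees of K_3 □ C_n, the box product of the complete graph on 3 vertices with the cycle graph on n vertices (defined for n ≥ 3). Then there exists N ≥ 3 such that for every n ≥ N, T_n = 58·T_{n-1} − 1131·T_{n-2} + 8700·T_{n-3} − 29493·T_{n-4} + 43734·T_{n-5} − 29493·T_{n-6} + 8700·T_{n-7} − 1131·T_{n-8} + 58·T_{n-9} − T_{n-10}. -/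
open SimpleGraph

/-- The number of spanning trees of `K_3 □ C_n`. -/
noncomputable def k3CylinderTreeCount (n : ℕ) : ℕ :=
  spanningTreeCount ((⊤ : SimpleGraph (Fin 3)) □ cycleGraph n)

namespace SimpleGraph

variable {V : Type*}

/-- The graph joining each vertex `v` to its parent `F v`. -/
def parentGraph (F : V → V) : SimpleGraph V :=
  SimpleGraph.fromRel fun v w => F v = w

theorem parentGraph_adj {F : V → V} {v w : V} :
    (parentGraph F).Adj v w ↔ v ≠ w ∧ (F v = w ∨ F w = v) :=
  SimpleGraph.fromRel_adj _ _ _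

/-- `F` is a parent function in `G` with root `r`: it fixes `r`, sends every other vertex to a
neighbour, and every vertex eventually reaches `r`. -/
structure IsParentFun (G : SimpleGraph V) (r : V) (F : V → V) : Prop where
  root : F r = r
  adj : ∀ v, v ≠ r → G.Adj v (F v)
  reach : ∀ v, ∃ k, F^[k] v = r

theorem IsParentFun.le {G : SimpleGraph V} {r : V} {F : V → V} (h : G.IsParentFun r F) :
    parentGraph F ≤ G := by
  have key : ∀ v, v ≠ F v → G.Adj v (F v) := fun v hv =>
    h.adj v (by rintro rfl; exact hv h.root.symm)
  intro v w hvw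
  obtain ⟨hne, rfl | rfl⟩ := parentGraph_adj.1 hvw
  · exact key _ hne
  · exact (key _ hne.symm).symm

theorem IsParentFun.connected {G : SimpleGraph V} {r : V} {F : V → V} (h : G.IsParentFun r F) :
    (parentGraph F).Connected := by
  have step : ∀ v, (parentGraph F).Reachable v (F v) := fun v => by
    by_cases hv : v = F v
    · rw [← hv]
    · exact (parentGraph_adj.2 ⟨hv, Or.inl rfl⟩).reachable
  have iter : ∀ k v, (parentGraph F).Reachable v (F^[k] v) := by
    intro k
    induction k with
    | zero => exact fun v => Reachable.refl _
    | succ k ih => exact fun v => (step v).trans (ih _)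
  have root : ∀ v, (parentGraph F).Reachable v r := fun v => by
    obtain ⟨k, hk⟩ := h.reach v
    exact hk ▸ iter k v
  exact (connected_iff _).2 ⟨fun v w => (root v).trans (root w).symm, ⟨r⟩⟩

theorem IsParentFun.isTree [Finite V] {G : SimpleGraph V} {r : V} {F : V → V}
    (h : G.IsParentFun r F) : (parentGraph F).IsTree := by
  classical
  have := Fintype.ofFinite V
  refine isTree_iff_connected_and_card.2 ⟨h.connected, ?_⟩
  refine le_antisymm ?_ h.connected.card_vert_le_card_edgeSet_add_one
  have hsub : (parentGraph F).edgeSet ⊆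
      ((Finset.univ.erase r).image fun v => s(v, F v) : Finset (Sym2 V)) := by
    intro e
    induction e with
    | _ v w =>
      intro he
      obtain ⟨hne, hF | hF⟩ := parentGraph_adj.1 he
      · refine Finset.mem_coe.2 (Finset.mem_image.2 ⟨v, ?_, by rw [hF]⟩)
        refine Finset.mem_erase.2 ⟨?_, Finset.mem_univ _⟩
        rintro rfl
        exact hne (h.root.symm.trans hF)
      · refine Finset.mem_coe.2 (Finset.mem_image.2 ⟨w, ?_, by rw [hF, Sym2.eq_swap]⟩)
        refine Finset.mem_erase.2 ⟨?_, Finset.mem_univ _⟩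
        rintro rfl
        exact hne (hF.symm.trans h.root)
  have h1 := Set.ncard_le_ncard hsub (Finset.finite_toSet _)
  rw [Set.ncard_coe_finset] at h1
  have h2 := h1.trans Finset.card_image_le
  rw [Finset.card_erase_of_mem (Finset.mem_univ r), Finset.card_univ] at h2
  have h3 : 0 < Fintype.card V := Fintype.card_pos_iff.2 ⟨r⟩
  rw [Nat.card_coe_set_eq, Nat.card_eq_fintype_card]
  omega

theorem IsParentFun.eq_of_parentGraph_eq {G : SimpleGraph V} {r : V} {F F' : V → V}
    (h : G.IsParentFun r F) (h' : G.IsParentFun r F')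
    (heq : parentGraph F = parentGraph F') : F = F' := by
  suffices ∀ k v, F'^[k] v = r → F v = F' v by
    funext v
    obtain ⟨k, hk⟩ := h'.reach v
    exact this k v hk
  intro k
  induction k with
  | zero => rintro v rfl; exact h.root.trans h'.root.symm
  | succ k ih =>
    intro v hv
    by_cases hr : v = r
    · subst hr; exact h.root.trans h'.root.symm
    by_contra hne
    have hadj : (parentGraph F).Adj v (F' v) :=
      heq ▸ parentGraph_adj.2 ⟨(h'.adj v hr).ne, Or.inl rfl⟩
    have hw : F (F' v) = v := (parentGraph_adj.1 hadj).2.resolve_left hne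
    have hwr : F' v ≠ r := fun hw' => hr (by rw [← hw, hw', h.root])
    have hback : F' (F' v) = v := (ih _ hv).symm.trans hw
    have hcyc : ∀ j, F'^[j] v = v ∨ F'^[j] v = F' v := by
      intro j
      induction j with
      | zero => exact Or.inl rfl
      | succ j ihj =>
        rw [Function.iterate_succ_apply']
        rcases ihj with hj | hj <;> rw [hj]
        · exact Or.inr rfl
        · exact Or.inl hback
    rcases hcyc (k + 1) with hj | hj
    · exact hr (hj.symm.trans hv)
    · exact hwr (hj.symm.trans hv)

theorem IsTree.exists_isParentFun {T : SimpleGraph V} (hT : T.IsTree) (r : V) :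
    ∃ F, T.IsParentFun r F ∧ parentGraph F = T := by
  classical
  have hstep : ∀ v, ∃ w, v ≠ r → T.Adj v w ∧ T.dist w r < T.dist v r := by
    intro v
    by_cases hv : v = r
    · exact ⟨v, fun h => absurd hv h⟩
    obtain ⟨p, hp⟩ := hT.connected.exists_walk_length_eq_dist v r
    cases p with
    | nil => exact absurd rfl hv
    | @cons _ w _ hadj q =>
      refine ⟨w, fun _ => ⟨hadj, ?_⟩⟩
      rw [← hp, Walk.length_cons]
      exact Nat.lt_succ_of_le (dist_le q)
  choose f hf using hstep
  have hF : T.IsParentFun r (fun v => if v = r then r else f v) := by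
    refine ⟨if_pos rfl, fun v hv => ?_, ?_⟩
    · simpa only [if_neg hv] using (hf v hv).1
    · intro v
      induction hd : T.dist v r using Nat.strong_induction_on generalizing v with
      | _ d ih =>
        by_cases hv : v = r
        · exact ⟨0, hv⟩
        · obtain ⟨k, hk⟩ := ih _ (hd ▸ (hf v hv).2) (f v) rfl
          exact ⟨k + 1, by rw [Function.iterate_succ_apply, if_neg hv]; exact hk⟩
  exact ⟨_, hF, le_antisymm hF.le
    ((isTree_iff_minimal_connected.1 hT).2 hF.connected hF.le)⟩

/-- Rooting a tree at `r` identifies the trees in `G` with the parent functions. -/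
theorem card_isParentFun [Finite V] (G : SimpleGraph V) (r : V) :
    Nat.card {F : V → V // G.IsParentFun r F} =
      Nat.card {T : SimpleGraph V // T ≤ G ∧ T.IsTree} := by
  refine Nat.card_congr (Equiv.ofBijective
    (fun F => ⟨parentGraph F.1, F.2.le, F.2.isTree⟩) ⟨?_, ?_⟩)
  · intro F F' h
    exact Subtype.ext (F.2.eq_of_parentGraph_eq F'.2 (Subtype.ext_iff.1 h))
  · rintro ⟨T, hTG, hT⟩
    obtain ⟨F, hF, rfl⟩ := hT.exists_isParentFun r
    exact ⟨⟨F, hF.root, fun v hv => hTG (hF.adj v hv), hF.reach⟩, rfl⟩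

theorem spanningTreeCount_eq_card_isTree (G : SimpleGraph V) :
    spanningTreeCount G = Nat.card {T : SimpleGraph V // T ≤ G ∧ T.IsTree} := by
  refine Nat.card_congr
    { toFun := fun H => ⟨H.1.spanningCoe, H.1.spanningCoe_le,
        (H.1.spanningCoeEquivCoeOfSpanning H.2.1).isTree_iff.2 H.2.2⟩
      invFun := fun T => ⟨toSubgraph T.1 T.2.1, toSubgraph.isSpanning _ _,
        ((toSubgraph T.1 T.2.1).spanningCoeEquivCoeOfSpanning
          (toSubgraph.isSpanning _ _)).isTree_iff.1 T.2.2⟩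
      left_inv := fun H => Subtype.ext (Subgraph.ext ?_ ?_)
      right_inv := fun T => Subtype.ext rfl }
  · exact (Set.eq_univ_of_forall H.2.1).symm
  · rfl

end SimpleGraph

namespace SimpleGraph

open Matrix

variable {V : Type*} [Fintype V] [DecidableEq V]

/-- The matrix of the map `F`, with the row of `r` replaced by zero. -/
def parentMatrix (r : V) (F : V → V) : Matrix V V ℝ :=
  Matrix.of fun v => if v = r then 0 else Pi.single (F v) 1

theorem parentMatrix_mulVec (r : V) (F : V → V) (g : V → ℝ) (v : V) :
    (parentMatrix r F *ᵥ g) v = if v = r then 0 else g (F v) := by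
  simp only [Matrix.mulVec, parentMatrix, Matrix.of_apply]
  split_ifs <;> simp

theorem det_one_sub_parentMatrix_of_reach {r : V} {F : V → V} (hr : F r = r)
    (h : ∀ v, ∃ k, F^[k] v = r) : (1 - parentMatrix r F).det = 1 := by
  have hpow : ∀ k (g : V → ℝ) v,
      ((parentMatrix r F ^ (k + 1)) *ᵥ g) v = (parentMatrix r F *ᵥ g) (F^[k] v) := by
    intro k
    induction k with
    | zero => simp
    | succ k ih =>
      intro g v
      rw [pow_succ', ← Matrix.mulVec_mulVec, parentMatrix_mulVec]
      split_ifs with hv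
      · subst hv
        rw [Function.iterate_fixed hr, parentMatrix_mulVec, if_pos rfl]
      · rw [ih, Function.iterate_succ_apply]
  choose k hk using h
  have hK : ∀ v, F^[∑ w, k w] v = r := by
    intro v
    rw [← Nat.sub_add_cancel (Finset.single_le_sum (fun w _ => Nat.zero_le (k w))
      (Finset.mem_univ v)), Function.iterate_add_apply, hk, Function.iterate_fixed hr]
  have hnil : IsNilpotent (parentMatrix r F) := by
    refine ⟨(∑ w, k w) + 1, Matrix.ext_of_mulVec_single fun j => ?_⟩
    funext v
    rw [hpow, hK, parentMatrix_mulVec]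
    simp
  have hchar := (Matrix.isNilpotent_charpoly_sub_pow_of_isNilpotent hnil).eq_zero
  have := congrArg (Polynomial.eval 1) (sub_eq_zero.1 hchar)
  simpa [Matrix.eval_charpoly] using this

theorem det_one_sub_parentMatrix_of_not_reach {r : V} {F : V → V} (hr : F r = r)
    (h : ¬ ∀ v, ∃ k, F^[k] v = r) : (1 - parentMatrix r F).det = 0 := by
  classical
  push Not at h
  obtain ⟨v, hv⟩ := h
  refine Matrix.exists_mulVec_eq_zero_iff.1
    ⟨fun w => if ∃ k, F^[k] w = r then 0 else 1, fun h0 => ?_, ?_⟩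
  · have := congrFun h0 v
    simp [hv] at this
  · funext w
    have hw : (∃ k, F^[k] (F w) = r) ↔ ∃ k, F^[k] w = r := by
      refine ⟨fun ⟨k, hk⟩ => ⟨k + 1, hk⟩, fun ⟨k, hk⟩ => ⟨k, ?_⟩⟩
      rw [← Function.iterate_succ_apply, Function.iterate_succ_apply', hk, hr]
    rw [Matrix.sub_mulVec, Matrix.one_mulVec, Pi.sub_apply, parentMatrix_mulVec]
    simp only [hw]
    split_ifs
    · simp
    · simp
    · exact absurd ⟨0, by assumption⟩ ‹¬∃ k, F^[k] w = r›
    · simp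

/-- The matrix-tree theorem: the number of spanning trees is a cofactor of the Laplacian. -/
theorem spanningTreeCount_eq_det (G : SimpleGraph V) [DecidableRel G.Adj] (r : V) :
    (spanningTreeCount G : ℝ) = ((G.lapMatrix ℝ).updateRow r (Pi.single r 1)).det := by
  classical
  let A : V → Finset V := fun v => if v = r then {r} else G.neighborFinset v
  have hrow : (G.lapMatrix ℝ).updateRow r (Pi.single r 1) =
      fun v => ∑ w ∈ A v, (Pi.single v 1 - if v = r then 0 else Pi.single w 1 : V → ℝ) := by
    funext v
    by_cases hv : v = r
    · subst hv
      simp [A]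
    · rw [Matrix.updateRow_ne hv]
      funext u
      simp only [A, if_neg hv, Finset.sum_apply, Pi.sub_apply, Finset.sum_sub_distrib,
        lapMatrix, degMatrix, Matrix.sub_apply, adjMatrix_apply, Matrix.diagonal_apply]
      simp [Pi.single_apply, eq_comm]
  have hdet := (Matrix.detRowAlternating (n := V) (R := ℝ)).toMultilinearMap.map_sum_finset
    (fun v w => (Pi.single v 1 - if v = r then 0 else Pi.single w 1 : V → ℝ)) A
  rw [hrow]
  refine Eq.trans ?_ hdet.symm
  have hterm : ∀ F ∈ Fintype.piFinset A,
      (Matrix.detRowAlternating (n := V) (R := ℝ)).toMultilinearMap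
        (fun v => (Pi.single v 1 - if v = r then 0 else Pi.single (F v) 1 : V → ℝ)) =
      if G.IsParentFun r F then 1 else 0 := by
    intro F hF
    rw [Fintype.mem_piFinset] at hF
    have hr : F r = r := by simpa [A] using hF r
    have hadj : ∀ v, v ≠ r → G.Adj v (F v) := fun v hv => by simpa [A, hv] using hF v
    have hmat : (fun v => (Pi.single v 1 - if v = r then 0 else Pi.single (F v) 1 : V → ℝ)) =
        (1 - parentMatrix r F : Matrix V V ℝ) := by
      funext v u
      simp [parentMatrix, Matrix.one_apply, Pi.single_apply, eq_comm]
    rw [hmat]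
    change (1 - parentMatrix r F).det = _
    split_ifs with h
    · exact det_one_sub_parentMatrix_of_reach hr h.reach
    · exact det_one_sub_parentMatrix_of_not_reach hr fun h' => h ⟨hr, hadj, h'⟩
  rw [Finset.sum_congr rfl hterm, Finset.sum_boole, spanningTreeCount_eq_card_isTree,
    ← card_isParentFun G r, Nat.card_eq_fintype_card, Fintype.card_subtype]
  congr 2
  ext F
  simp only [Finset.mem_filter, Finset.mem_univ, true_and, Fintype.mem_piFinset]
  refine ⟨fun h => ⟨fun v => ?_, h⟩, fun h => h.2⟩
  by_cases hv : v = r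
  · simp [A, hv, h.root]
  · simpa [A, hv] using h.adj v hv

end SimpleGraph

namespace Matrix

open scoped Kronecker

variable {V : Type*} [Fintype V] [DecidableEq V]

theorem det_one_add_vecMulVec (u v : V → ℝ) : (1 + vecMulVec u v).det = 1 + v ⬝ᵥ u := by
  rw [vecMulVec_eq Unit, det_one_add_replicateCol_mul_replicateRow]

/-- If all rows and columns of `L` sum to zero, then the determinant of a rank-one perturbation
of `L` depends only on the coordinate sums of the two vectors. -/
theorem det_add_vecMulVec_of_sum_eq_zero {L : Matrix V V ℝ} (hrow : L *ᵥ 1 = 0)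
    (hcol : 1 ᵥ* L = 0) (r : V) (u v : V → ℝ) :
    (L + vecMulVec u v).det = (∑ i, u i) * (∑ i, v i) *
      (L + vecMulVec (Pi.single r 1) (Pi.single r 1)).det := by
  have hfac : (1 + vecMulVec (u - Pi.single r 1) 1) *
      (L + vecMulVec (Pi.single r 1) (Pi.single r 1)) *
      (1 + vecMulVec 1 (v - Pi.single r 1)) = L + vecMulVec u v := by
    have h1 : (1 + vecMulVec (u - Pi.single r 1) 1) *
        (L + vecMulVec (Pi.single r 1) (Pi.single r 1)) = L + vecMulVec u (Pi.single r 1) := by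
      rw [add_mul, one_mul, mul_add, vecMulVec_mul, hcol, vecMulVec_mul, vecMul_vecMulVec]
      ext i j
      simp [vecMulVec_apply]
      ring
    rw [h1, mul_add, mul_one, add_mul, mul_vecMulVec, hrow, mul_vecMulVec, vecMulVec_mulVec]
    ext i j
    simp [vecMulVec_apply]
    ring
  rw [← hfac, det_mul, det_mul, det_one_add_vecMulVec, det_one_add_vecMulVec]
  simp only [one_dotProduct, dotProduct_one, Pi.sub_apply, Finset.sum_sub_distrib,
    Finset.sum_pi_single', Finset.mem_univ, if_true]
  simp
  ring

theorem det_one_kronecker_add (A B : Matrix V V ℝ) :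
    ((1 : Matrix (Fin 3) (Fin 3) ℝ) ⊗ₖ A + (of fun _ _ => 1) ⊗ₖ B).det =
      (A + (3 : ℝ) • B).det * A.det ^ 2 := by
  let Q : Matrix (Fin 3) (Fin 3) ℝ := !![1, 1, 1; 1, -1, 0; 0, 1, -1]
  let d : Fin 3 → ℝ := ![3, 0, 0]
  have hQ : Q * (of fun _ _ => 1) = diagonal d * Q := by
    ext i j
    rw [diagonal_mul, Matrix.mul_apply, Fin.sum_univ_three]
    fin_cases i <;> fin_cases j <;> simp [Q, d] <;> norm_num
  have hQdet : Q.det = 3 := by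
    simp [Q, det_fin_three]; norm_num
  have hconj : (Q ⊗ₖ (1 : Matrix V V ℝ)) *
      ((1 : Matrix (Fin 3) (Fin 3) ℝ) ⊗ₖ A + (of fun _ _ => 1) ⊗ₖ B) =
      ((1 : Matrix (Fin 3) (Fin 3) ℝ) ⊗ₖ A + diagonal d ⊗ₖ B) *
        (Q ⊗ₖ (1 : Matrix V V ℝ)) := by
    rw [mul_add, add_mul, ← mul_kronecker_mul, ← mul_kronecker_mul, ← mul_kronecker_mul,
      ← mul_kronecker_mul, hQ]
    simp
  have hblock : (1 : Matrix (Fin 3) (Fin 3) ℝ) ⊗ₖ A + diagonal d ⊗ₖ B =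
      reindex (Equiv.prodComm _ _) (Equiv.prodComm _ _) (blockDiagonal fun i => A + d i • B) := by
    rw [← diagonal_one, diagonal_kronecker, diagonal_kronecker]
    ext i j
    simp [blockDiagonal_apply]
    split_ifs <;> simp
  have hdet := congrArg det hconj
  rw [det_mul, det_mul, mul_comm] at hdet
  have hne : (Q ⊗ₖ (1 : Matrix V V ℝ)).det ≠ 0 := by
    rw [det_kronecker, hQdet]
    simp
  rw [mul_right_cancel₀ hne hdet, hblock, det_reindex_self, det_blockDiagonal,
    Fin.prod_univ_three]
  simp [d]
  ring

/-- The permutation matrix of the cyclic shift `i ↦ i + 1`. -/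
def cyclicShift (m : ℕ) : Matrix (Fin (m + 1)) (Fin (m + 1)) ℝ :=
  of fun i => Pi.single (i + 1) 1

theorem cyclicShift_mul_apply {m : ℕ} (M : Matrix (Fin (m + 1)) (Fin (m + 1)) ℝ) (i j) :
    (cyclicShift m * M) i j = M (i + 1) j := by
  simp [Matrix.mul_apply, cyclicShift, Pi.single_apply]

theorem cyclicShift_mulVec {m : ℕ} (g : Fin (m + 1) → ℝ) (i) :
    (cyclicShift m *ᵥ g) i = g (i + 1) := by
  simp [Matrix.mulVec, cyclicShift]

theorem cyclicShift_mul_transpose (m : ℕ) : cyclicShift m * (cyclicShift m)ᵀ = 1 := by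
  ext i j
  rw [cyclicShift_mul_apply]
  simp [cyclicShift, one_apply, Pi.single_apply]

/-- Cutting the cycle open makes the shift upper triangular. -/
theorem det_smul_one_sub_cyclicShift_add (m : ℕ) (a : ℝ) :
    (a • 1 - cyclicShift (m + 1) +
      vecMulVec (Pi.single (Fin.last _) 1) (Pi.single 0 1)).det = a ^ (m + 2) := by
  rw [det_of_isUpperTriangular]
  · refine (Finset.prod_congr rfl (g := fun _ => a) fun i _ => ?_).trans (by simp)
    induction i using Fin.lastCases with
    | last => simp [cyclicShift, vecMulVec_apply]
    | cast k => simp [cyclicShift, vecMulVec_apply, Fin.castSucc_ne_last,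
        Fin.coeSucc_eq_succ, Pi.single_apply, (Fin.castSucc_lt_succ (i := k)).ne]
  · intro i j hij
    have hji : j < i := hij
    induction i using Fin.lastCases with
    | last => simp [cyclicShift, vecMulVec_apply, Pi.single_apply, hji.ne']
    | cast k =>
      have hjk : j ≠ k.succ := (hji.trans Fin.castSucc_lt_succ).ne
      simp [cyclicShift, vecMulVec_apply, Fin.castSucc_ne_last,
        Fin.coeSucc_eq_succ, Pi.single_apply, hji.ne', hjk]

theorem det_smul_one_sub_cyclicShift (m : ℕ) {a : ℝ} (ha : a ≠ 0) :
    (a • 1 - cyclicShift (m + 1)).det = a ^ (m + 2) - 1 := by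
  let E : Matrix (Fin (m + 2)) (Fin (m + 2)) ℝ :=
    vecMulVec (Pi.single (Fin.last _) 1) (Pi.single 0 1)
  let w : Fin (m + 2) → ℝ := fun i => a ^ (i : ℕ) / a ^ (m + 2)
  have hw : (a • 1 - cyclicShift (m + 1) + E) *ᵥ w = Pi.single (Fin.last _) 1 := by
    funext i
    rw [add_mulVec, sub_mulVec, smul_mulVec, one_mulVec, vecMulVec_mulVec, Pi.add_apply,
      Pi.sub_apply, cyclicShift_mulVec]
    induction i using Fin.lastCases with
    | last =>
      simp [w]
      field_simp
      ring
    | cast k =>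
      simp [w, Fin.coeSucc_eq_succ, Fin.castSucc_ne_last]
      field_simp
      ring
  have hfac : a • 1 - cyclicShift (m + 1) =
      (a • 1 - cyclicShift (m + 1) + E) * (1 + vecMulVec w (-Pi.single 0 1)) := by
    rw [mul_add, mul_one, mul_vecMulVec, hw, vecMulVec_neg]
    simp [E]
  rw [hfac, det_mul, det_smul_one_sub_cyclicShift_add, det_one_add_vecMulVec]
  simp [w]
  field_simp
  ring

/-- The Laplacian matrix of the cycle of length `m + 1`. -/
def cycleLaplacian (m : ℕ) : Matrix (Fin (m + 1)) (Fin (m + 1)) ℝ :=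
  (1 - cyclicShift m) * (1 - cyclicShift m)ᵀ

theorem cycleLaplacian_eq (m : ℕ) :
    cycleLaplacian m = (2 : ℝ) • 1 - cyclicShift m - (cyclicShift m)ᵀ := by
  rw [cycleLaplacian, transpose_sub, transpose_one, sub_mul, mul_sub, mul_sub,
    cyclicShift_mul_transpose, one_mul, one_mul, mul_one, two_smul]
  abel

theorem det_cycleLaplacian_add_smul_one (m : ℕ) {a x : ℝ} (ha : a ≠ 0)
    (hx : a ^ 2 + 1 = a * (2 + x)) :
    a ^ (m + 2) * (cycleLaplacian (m + 1) + x • 1).det = (a ^ (m + 2) - 1) ^ 2 := by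
  have hfac : (a • 1 - cyclicShift (m + 1)) * (a • 1 - cyclicShift (m + 1))ᵀ =
      a • (cycleLaplacian (m + 1) + x • 1) := by
    rw [cycleLaplacian_eq, transpose_sub, transpose_smul, transpose_one, sub_mul, mul_sub, mul_sub,
      cyclicShift_mul_transpose]
    simp only [smul_mul_assoc, mul_smul_comm, one_mul, mul_one]
    ext i j
    simp only [sub_apply, add_apply, smul_apply, smul_eq_mul]
    linear_combination (1 : Matrix (Fin (m + 2)) (Fin (m + 2)) ℝ) i j * hx
  have hdet := congrArg det hfac
  rw [det_mul, det_transpose, det_smul_one_sub_cyclicShift m ha, det_smul, Fintype.card_fin]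
    at hdet
  rw [← hdet]
  ring

theorem cyclicShift_mulVec_one (m : ℕ) : cyclicShift m *ᵥ 1 = 1 := by
  funext i
  rw [cyclicShift_mulVec]
  rfl

theorem cycleLaplacian_mulVec_one (m : ℕ) : cycleLaplacian m *ᵥ 1 = 0 := by
  rw [cycleLaplacian_eq, sub_mulVec, sub_mulVec, smul_mulVec, cyclicShift_mulVec_one]
  have h : (cyclicShift m)ᵀ *ᵥ 1 = 1 := by
    conv_lhs => rw [← cyclicShift_mulVec_one, mulVec_mulVec,
      mul_eq_one_comm.1 (cyclicShift_mul_transpose m), one_mulVec]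
  rw [h, one_mulVec, two_smul]
  simp

theorem cycleLaplacian_transpose (m : ℕ) : (cycleLaplacian m)ᵀ = cycleLaplacian m := by
  rw [cycleLaplacian, transpose_mul, transpose_transpose]

theorem one_vecMul_cycleLaplacian (m : ℕ) : 1 ᵥ* cycleLaplacian m = 0 := by
  rw [← cycleLaplacian_transpose, vecMul_transpose, cycleLaplacian_mulVec_one]

theorem det_cycleLaplacian_add_vecMulVec (m : ℕ) :
    (cycleLaplacian (m + 1) +
      vecMulVec (Pi.single (Fin.last _) 1) (Pi.single 0 1)).det = (m : ℝ) + 2 := by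
  set p : Fin (m + 2) → ℝ := Pi.single (Fin.last _) 1
  set q : Fin (m + 2) → ℝ := Pi.single 0 1
  set D : Matrix (Fin (m + 2)) (Fin (m + 2)) ℝ := 1 - cyclicShift (m + 1) with hD
  have hDone : D *ᵥ 1 = 0 := by
    rw [hD, sub_mulVec, one_mulVec, cyclicShift_mulVec_one, sub_self]
  have hDq : D *ᵥ q = q - p := by
    rw [hD, sub_mulVec, one_mulVec]
    congr 1
    funext i
    rw [cyclicShift_mulVec]
    induction i using Fin.lastCases with
    | last => simp [p, q]
    | cast k => simp [p, q, Fin.coeSucc_eq_succ, Fin.castSucc_ne_last]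
  have hq1 : q ⬝ᵥ 1 = 1 := by simp [q]
  have hqq : q ⬝ᵥ q = 1 := by simp [q]
  have hUdet : (D + vecMulVec p q).det = 1 := by
    simpa using det_smul_one_sub_cyclicShift_add m 1
  have hUone : (D + vecMulVec p q) *ᵥ 1 = p := by
    rw [add_mulVec, hDone, vecMulVec_mulVec, hq1]
    simp
  have hUq : (D + vecMulVec p q) *ᵥ q = q := by
    rw [add_mulVec, hDq, vecMulVec_mulVec, hqq]
    simp
  have hfac : cycleLaplacian (m + 1) + vecMulVec p q =
      (D + vecMulVec p q) * (1 + vecMulVec (1 - q) 1) * (D + vecMulVec p q)ᵀ := by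
    rw [mul_add, mul_one, mul_vecMulVec, mulVec_sub, hUone, hUq, add_mul, vecMulVec_mul,
      vecMul_transpose, hUone, transpose_add, add_mul, mul_add, mul_add, transpose_vecMulVec,
      mul_vecMulVec, vecMulVec_mul, vecMul_transpose, hDq, vecMulVec_mul_vecMulVec, hqq]
    change D * Dᵀ + _ = _
    ext i j
    simp [vecMulVec_apply]
    ring
  rw [hfac, det_mul, det_mul, det_transpose, hUdet, det_one_add_vecMulVec]
  simp [q]
  ring

end Matrix

namespace SimpleGraph

open Matrix
open scoped Kronecker

theorem spanningTreeCount_mul_sum {V : Type*} [Fintype V] [DecidableEq V] [Nonempty V]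
    (G : SimpleGraph V) [DecidableRel G.Adj] (u v : V → ℝ) :
    (∑ i, u i) * (∑ i, v i) * spanningTreeCount G = (G.lapMatrix ℝ + vecMulVec u v).det := by
  obtain ⟨r⟩ := ‹Nonempty V›
  have hrow : G.lapMatrix ℝ *ᵥ 1 = 0 := G.lapMatrix_mulVec_const_eq_zero
  have hcol : 1 ᵥ* G.lapMatrix ℝ = 0 := by
    rw [← (G.isSymm_lapMatrix (R := ℝ)).eq, vecMul_transpose, hrow]
  have hupd : G.lapMatrix ℝ + vecMulVec (Pi.single r 1) (Pi.single r 1) =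
      (G.lapMatrix ℝ).updateRow r (G.lapMatrix ℝ r + Pi.single r 1) := by
    ext i j
    by_cases hi : i = r
    · subst hi
      simp [vecMulVec_apply]
    · simp [vecMulVec_apply, hi]
  have : Nonempty V := ⟨r⟩
  rw [det_add_vecMulVec_of_sum_eq_zero hrow hcol r, hupd, det_updateRow_add, updateRow_eq_self,
    det_lapMatrix_eq_zero, zero_add, spanningTreeCount_eq_det G r]

theorem lapMatrix_boxProd {V W : Type*} [Fintype V] [DecidableEq V] [Fintype W] [DecidableEq W]
    (G : SimpleGraph V) (H : SimpleGraph W) [DecidableRel G.Adj] [DecidableRel H.Adj]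
    [DecidableRel (G □ H).Adj] :
    (G □ H).lapMatrix ℝ = G.lapMatrix ℝ ⊗ₖ 1 + 1 ⊗ₖ H.lapMatrix ℝ := by
  ext ⟨i, j⟩ ⟨k, l⟩
  simp only [lapMatrix, degMatrix, Matrix.sub_apply, Matrix.add_apply, kroneckerMap_apply,
    Matrix.diagonal_apply, adjMatrix_apply, boxProd_adj, Matrix.one_apply, degree_boxProd,
    Prod.mk.injEq]
  by_cases hik : i = k <;> by_cases hjl : j = l <;> simp [hik, hjl]

theorem lapMatrix_top_fin_three :
    (⊤ : SimpleGraph (Fin 3)).lapMatrix ℝ = (3 : ℝ) • 1 - of fun _ _ => 1 := by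
  ext i j
  by_cases hij : i = j <;>
    simp [lapMatrix, degMatrix, hij]
  norm_num

theorem lapMatrix_cycleGraph (m : ℕ) [DecidableRel (cycleGraph (m + 3)).Adj] :
    (cycleGraph (m + 3)).lapMatrix ℝ = cycleLaplacian (m + 2) := by
  ext i j
  have hne : ∀ x : Fin (m + 3), x ≠ x + 1 + 1 := by
    intro x hx
    rw [add_assoc, left_eq_add] at hx
    have := congrArg Fin.val hx
    rw [Fin.val_add, Fin.val_zero, Fin.val_one, Nat.mod_eq_of_lt (by omega)] at this
    omega
  have hdeg : (cycleGraph (m + 3)).degree i = 2 := by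
    convert cycleGraph_degree_three_le (v := i)
  simp only [cycleLaplacian_eq, lapMatrix, degMatrix, Matrix.sub_apply, Matrix.diagonal_apply,
    adjMatrix_apply, cyclicShift, transpose_apply, of_apply, Matrix.smul_apply, Matrix.one_apply,
    Pi.single_apply, hdeg, cycleGraph_adj, sub_eq_iff_eq_add']
  by_cases hij : i = j
  · subst hij
    simp
  · by_cases h : i = j + 1
    · subst h
      simp [hne]
    · by_cases h' : j = i + 1
      · subst h'
        simp [hne]
      · simp [hij, h, h']

theorem three_mul_k3CylinderTreeCount {a b : ℝ} (hab : a * b = 1) (hsum : a + b = 5) {n : ℕ}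
    (hn : 3 ≤ n) : 3 * (k3CylinderTreeCount n : ℝ) = n * (a ^ n + b ^ n - 2) ^ 2 := by
  classical
  obtain ⟨m, rfl⟩ := Nat.exists_eq_add_of_le' hn
  have ha : a ≠ 0 := left_ne_zero_of_mul_eq_one hab
  have hpow : a ^ (m + 3) * b ^ (m + 3) = 1 := by rw [← mul_pow, hab, one_pow]
  let p : Fin (m + 3) → ℝ := Pi.single (Fin.last _) 1
  let q : Fin (m + 3) → ℝ := Pi.single 0 1
  have hC : (cycleLaplacian (m + 2) + (3 : ℝ) • 1).det = a ^ (m + 3) + b ^ (m + 3) - 2 := by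
    have h := det_cycleLaplacian_add_smul_one (m + 1) (x := 3) ha
      (by linear_combination a * hsum - hab)
    linear_combination b ^ (m + 3) * h + (a ^ (m + 3) - 2 -
      (cycleLaplacian (m + 2) + (3 : ℝ) • 1).det) * hpow
  have hC' : (cycleLaplacian (m + 2) + (3 : ℝ) • vecMulVec p q).det = 3 * ((m : ℝ) + 3) := by
    have h := fun u v => det_add_vecMulVec_of_sum_eq_zero (cycleLaplacian_mulVec_one (m + 2))
      (one_vecMul_cycleLaplacian (m + 2)) 0 u v
    have h1 : (cycleLaplacian (m + 2) + vecMulVec p q).det = _ :=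
      det_cycleLaplacian_add_vecMulVec (m + 1)
    rw [h] at h1
    have hp : ∑ j, p j = 1 := by simp [p]
    have hq : ∑ j, q j = 1 := by simp [q]
    have hp3 : ∑ j, ((3 : ℝ) • p) j = 3 := by
      simp only [Pi.smul_apply, smul_eq_mul, ← Finset.mul_sum, hp, mul_one]
    rw [hp, hq, one_mul, one_mul] at h1
    rw [← smul_vecMulVec, h, hp3, hq, h1]
    push_cast
    ring
  have hT := spanningTreeCount_mul_sum ((⊤ : SimpleGraph (Fin 3)) □ cycleGraph (m + 3))
    (fun x => p x.2) (fun x => q x.2)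
  have hK : ((⊤ : SimpleGraph (Fin 3)) □ cycleGraph (m + 3)).lapMatrix ℝ +
      vecMulVec (fun x => p x.2) (fun x => q x.2) =
      (1 : Matrix (Fin 3) (Fin 3) ℝ) ⊗ₖ (cycleLaplacian (m + 2) + (3 : ℝ) • 1) +
        (of fun _ _ => 1) ⊗ₖ (vecMulVec p q - 1) := by
    rw [lapMatrix_boxProd, lapMatrix_top_fin_three, lapMatrix_cycleGraph]
    ext ⟨i, j⟩ ⟨k, l⟩
    simp only [Matrix.sub_apply, Matrix.add_apply, kroneckerMap_apply, Matrix.smul_apply,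
      vecMulVec_apply, of_apply, smul_eq_mul]
    ring
  have hblock : cycleLaplacian (m + 2) + (3 : ℝ) • 1 + (3 : ℝ) • (vecMulVec p q - 1) =
      cycleLaplacian (m + 2) + (3 : ℝ) • vecMulVec p q := by
    rw [smul_sub]
    abel
  rw [hK, det_one_kronecker_add, hblock, hC, hC', Fintype.sum_prod_type,
    Fintype.sum_prod_type] at hT
  have hp : ∑ j, p j = 1 := by simp [p]
  have hq : ∑ j, q j = 1 := by simp [q]
  simp only [hp, hq, Finset.sum_const, Finset.card_univ, Fintype.card_fin] at hT
  norm_num at hT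
  rw [k3CylinderTreeCount]
  push_cast
  linarith

end SimpleGraph

theorem k3CylinderTreeCount_recurrence :
    ∃ N : ℕ, 3 ≤ N ∧
      ∀ n : ℕ, N ≤ n →
        (k3CylinderTreeCount n : ℤ) =
          58 * k3CylinderTreeCount (n - 1)
          - 1131 * k3CylinderTreeCount (n - 2)
          + 8700 * k3CylinderTreeCount (n - 3)
          - 29493 * k3CylinderTreeCount (n - 4)
          + 43734 * k3CylinderTreeCount (n - 5)
          - 29493 * k3CylinderTreeCount (n - 6)
          + 8700 * k3CylinderTreeCount (n - 7)
          - 1131 * k3CylinderTreeCount (n - 8)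
          + 58 * k3CylinderTreeCount (n - 9)
          - k3CylinderTreeCount (n - 10) := by
  refine ⟨13, by norm_num, fun n hn => ?_⟩
  obtain ⟨k, rfl⟩ := Nat.exists_eq_add_of_le' (show 10 ≤ n by omega)
  have hs : √(21 : ℝ) * √21 = 21 := Real.mul_self_sqrt (by norm_num)
  obtain ⟨a, b, hab, hsum⟩ : ∃ a b : ℝ, a * b = 1 ∧ a + b = 5 :=
    ⟨(5 + √21) / 2, (5 - √21) / 2, by linear_combination -hs / 4, by ring⟩
  have hT : ∀ i, 3 ≤ k + i → 3 * (k3CylinderTreeCount (k + i) : ℝ) =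
      ((k : ℝ) + i) * ((a ^ k * a ^ i) ^ 2 + (b ^ k * b ^ i) ^ 2 -
        4 * (a ^ k * a ^ i) - 4 * (b ^ k * b ^ i) + 6) := by
    intro i hi
    have hpow : a ^ k * a ^ i * (b ^ k * b ^ i) = 1 := by
      rw [← pow_add, ← pow_add, ← mul_pow, hab, one_pow]
    rw [SimpleGraph.three_mul_k3CylinderTreeCount hab hsum hi, pow_add, pow_add]
    push_cast
    linear_combination 2 * ((k : ℝ) + i) * hpow
  have ha : a ^ 2 = 5 * a - 1 := by linear_combination a * hsum - hab
  have hb : b ^ 2 = 5 * b - 1 := by linear_combination b * hsum - hab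
  have h0 := hT 0 (by omega)
  have h1 := hT 1 (by omega)
  have h2 := hT 2 (by omega)
  have h3 := hT 3 (by omega)
  have h4 := hT 4 (by omega)
  have h5 := hT 5 (by omega)
  have h6 := hT 6 (by omega)
  have h7 := hT 7 (by omega)
  have h8 := hT 8 (by omega)
  have h9 := hT 9 (by omega)
  have h10 := hT 10 (by omega)
  have hred : ∀ c : ℝ, c ^ 2 = 5 * c - 1 →
      c ^ 3 = 24 * c - 5 ∧ c ^ 4 = 115 * c - 24 ∧ c ^ 5 = 551 * c - 115 ∧
      c ^ 6 = 2640 * c - 551 ∧ c ^ 7 = 12649 * c - 2640 ∧ c ^ 8 = 60605 * c - 12649 ∧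
      c ^ 9 = 290376 * c - 60605 ∧ c ^ 10 = 1391275 * c - 290376 := by
    intro c hc
    have h3 : c ^ 3 = 24 * c - 5 := by linear_combination (c + 5) * hc
    have h4 : c ^ 4 = 115 * c - 24 := by linear_combination c * h3 + 24 * hc
    have h5 : c ^ 5 = 551 * c - 115 := by linear_combination c * h4 + 115 * hc
    have h6 : c ^ 6 = 2640 * c - 551 := by linear_combination c * h5 + 551 * hc
    have h7 : c ^ 7 = 12649 * c - 2640 := by linear_combination c * h6 + 2640 * hc
    have h8 : c ^ 8 = 60605 * c - 12649 := by linear_combination c * h7 + 12649 * hc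
    have h9 : c ^ 9 = 290376 * c - 60605 := by linear_combination c * h8 + 60605 * hc
    have h10 : c ^ 10 = 1391275 * c - 290376 := by linear_combination c * h9 + 290376 * hc
    exact ⟨h3, h4, h5, h6, h7, h8, h9, h10⟩
  obtain ⟨a3, a4, a5, a6, a7, a8, a9, a10⟩ := hred a ha
  obtain ⟨b3, b4, b5, b6, b7, b8, b9, b10⟩ := hred b hb
  norm_num at h0 h1 h2 h3 h4 h5 h6 h7 h8 h9 h10
  rw [ha, hb] at h2
  rw [a3, b3] at h3
  rw [a4, b4] at h4
  rw [a5, b5] at h5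
  rw [a6, b6] at h6
  rw [a7, b7] at h7
  rw [a8, b8] at h8
  rw [a9, b9] at h9
  rw [a10, b10] at h10
  have hreal : (k3CylinderTreeCount (k + 10) : ℝ) =
      58 * k3CylinderTreeCount (k + 9) - 1131 * k3CylinderTreeCount (k + 8)
        + 8700 * k3CylinderTreeCount (k + 7) - 29493 * k3CylinderTreeCount (k + 6)
        + 43734 * k3CylinderTreeCount (k + 5) - 29493 * k3CylinderTreeCount (k + 4)
        + 8700 * k3CylinderTreeCount (k + 3) - 1131 * k3CylinderTreeCount (k + 2)
        + 58 * k3CylinderTreeCount (k + 1) - k3CylinderTreeCount k := by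
    linear_combination (h10 - 58 * h9 + 1131 * h8 - 8700 * h7 + 29493 * h6
      - 43734 * h5 + 29493 * h4 - 8700 * h3 + 1131 * h2 - 58 * h1 + h0) / 3
  exact_mod_cast hreal
end
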